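/- arXiv:2511.06109 — 2 statements merged into one kernel-verified Lean document; each statement's English description precedes it below -/
import Mathlib

section
/- (Hardy's theorem) The Riemann zeta function has infinitely many zeros on the critical line: the set {t ∈ ℝ : ζ(1/2 + it) = 0} is infinite. -/
open Complex

open scoped Real in
/-- theta -/
noncomputable def hTh (z : ℂ) : ℂ := jacobiTheta (I * z)

open scoped Real in
lemma hTh_hasSum {z : ℂ} (hz : 0 < z.re) :
    HasSum (fun n : ℤ => cexp (-π * (n : ℂ) ^ 2 * z)) (hTh z) := by
  have h := hasSum_jacobiTheta₂_term 0 (τ := I * z) (by simpa using hz)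
  rw [← jacobiTheta_eq_jacobiTheta₂] at h
  refine h.congr_fun ?_ |> fun h => h
  intro n
  simp only [jacobiTheta₂_term]
  congr 1
  linear_combination (-(π * (n:ℂ)^2 * z)) * I_sq

open scoped Real in
lemma hTh_nat_hasSum {z : ℂ} (hz : 0 < z.re) :
    HasSum (fun n : ℕ => cexp (-π * ((n : ℂ) + 1) ^ 2 * z)) ((hTh z - 1) / 2) := by
  have h := hasSum_nat_jacobiTheta (τ := I * z) (by simpa using hz)
  refine h.congr_fun ?_ |> fun h => h
  intro n
  congr 1
  linear_combination (-(π * ((n:ℂ)+1)^2 * z)) * I_sq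

open scoped Real in
lemma hTh_norm_aux {z : ℂ} (hz : 0 < z.re) :
    ‖hTh z - 1‖ ≤ 2 / (Real.exp (π * z.re) - 1) := by
  have h := norm_jacobiTheta_sub_one_le (τ := I * z) (by simpa using hz)
  refine h.trans (le_of_eq ?_)
  have : (I * z).im = z.re := by simp
  rw [this, neg_mul, Real.exp_neg]
  have h1 : 1 < Real.exp (π * z.re) := Real.one_lt_exp_iff.2 (by positivity)
  have : Real.exp (π * z.re) - 1 ≠ 0 := by linarith
  field_simp

open scoped Real in
lemma hTh_norm_one {z : ℂ} (hz : 0 < z.re) : ‖hTh z - 1‖ ≤ 2 / z.re := by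
  refine (hTh_norm_aux hz).trans ?_
  have := Real.add_one_le_exp (π * z.re)
  have := Real.pi_gt_three
  gcongr
  nlinarith

open scoped Real in
lemma hTh_norm_two {z : ℂ} (hz : 0 < z.re) : ‖hTh z - 1‖ ≤ 4 / z.re ^ 2 := by
  refine (hTh_norm_aux hz).trans ?_
  have h0 : 0 < π * z.re := by positivity
  have := Real.quadratic_le_exp_of_nonneg h0.le
  have := Real.pi_gt_three
  have h9 : z.re ^ 2 ≤ (π * z.re)^2 := by
    gcongr; nlinarith
  have : (4:ℝ) / z.re ^ 2 = 2 / (z.re ^2 / 2) := by field_simp; norm_num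
  rw [this]
  gcongr
  nlinarith

lemma hTh_inv {z : ℂ} (hz : 0 < z.re) : hTh z = 1 / z ^ (1 / 2 : ℂ) * hTh z⁻¹ := by
  have hz0 : z ≠ 0 := by rintro rfl; simp at hz
  have h := jacobiTheta₂_functional_equation 0 (I * z)
  rw [hTh, hTh, jacobiTheta_eq_jacobiTheta₂, jacobiTheta_eq_jacobiTheta₂, h]
  have e1 : -I * (I * z) = z := by linear_combination (-z) * I_sq
  have e2 : -1 / (I * z) = I * z⁻¹ := by
    field_simp; simp
  simp [e1, e2]

lemma hTh_period (z : ℂ) : hTh (z + 2 * I) = hTh z := by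
  have h := jacobiTheta_two_add (I * (z + 2 * I))
  rw [hTh, hTh, ← h]
  congr 1
  linear_combination (2 : ℂ) * I_sq

lemma hTh_period' (k : ℕ) (z : ℂ) : hTh (z + 2 * k * I) = hTh z := by
  induction k with
  | zero => simp
  | succ k ih => 
    rw [← ih, ← hTh_period (z + 2 * k * I)]
    congr 1; push_cast; ring

lemma hTh_conj {z : ℂ} (hz : 0 < z.re) :
    hTh ((starRingEnd ℂ) z) = (starRingEnd ℂ) (hTh z) := by
  have h1 := hTh_hasSum hz
  have h2 := hTh_hasSum (z := (starRingEnd ℂ) z) (by simpa using hz)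
  have h3 := (hasSum_conj (f := fun n : ℤ => (starRingEnd ℂ) (cexp (-Real.pi * (n : ℂ) ^ 2 * z)))
    (x := hTh z)).1 (by simpa using h1)
  refine h2.unique ?_
  convert h3 using 2 with n
  rw [← exp_conj]; simp

open scoped Real in
lemma hTh_I_add {z : ℂ} (hz : 0 < z.re) : hTh (z + I) = 2 * hTh (4 * z) - hTh z := by
  have h1 := hTh_hasSum hz
  have h2 := hTh_hasSum (z := 4 * z) (by simpa using hz)
  have h3 := hTh_hasSum (z := z + I) (by simpa using hz)
  have hinj : Function.Injective (fun m : ℤ => 2 * m) := fun a b h => by simpa using h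
  have h2' : HasSum (Function.extend (fun m : ℤ => 2 * m)
      (fun n : ℤ => cexp (-π * (n : ℂ) ^ 2 * (4 * z))) 0) (hTh (4 * z)) :=
    (hasSum_extend_zero hinj).2 h2
  refine h3.unique ?_
  refine ((h2'.mul_left 2).sub h1).congr_fun ?_ |> fun h => h
  intro n
  rcases Int.even_or_odd' n with ⟨m, rfl | rfl⟩
  · rw [hinj.extend_apply (f := fun m : ℤ => 2 * m)]
    have : cexp (-π * ((2 * m : ℤ) : ℂ) ^ 2 * (z + I)) = cexp (-π * ((2 * m : ℤ) : ℂ) ^ 2 * z) := by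
      rw [Complex.exp_eq_exp_iff_exists_int]
      refine ⟨-(2 * m ^ 2), ?_⟩
      push_cast; ring
    rw [this]
    have : cexp (-π * ((m : ℤ) : ℂ) ^ 2 * (4 * z)) = cexp (-π * ((2 * m : ℤ) : ℂ) ^ 2 * z) := by
      congr 1; push_cast; ring
    rw [this]; ring
  · rw [Function.extend_apply']
    · have : -π * ((2 * m + 1 : ℤ) : ℂ) ^ 2 * (z + I) =
        -π * ((2 * m + 1 : ℤ) : ℂ) ^ 2 * z + π * I + ((-(2 * m ^ 2 + 2 * m + 1) : ℤ) : ℂ) * (2 * π * I) := by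
        push_cast; ring
      rw [this, Complex.exp_periodic.int_mul, Complex.exp_add, Complex.exp_pi_mul_I]
      simp
    · rintro ⟨a, ha⟩
      omega

lemma hTh_continuousAt {z : ℂ} (hz : 0 < z.re) : ContinuousAt hTh z := by
  have := continuousAt_jacobiTheta (τ := I * z) (by simpa using hz)
  exact ContinuousAt.comp (f := fun z => I * z) (g := jacobiTheta) this (by fun_prop)


/-- The combination of theta functions. -/
noncomputable def hG (z : ℂ) : ℂ := 4 * hTh z - 3 * hTh (9 * z) - hTh (z / 9)

lemma hG_norm {z : ℂ} (hz : 0 < z.re) : ‖hG z‖ ≤ 400 / z.re ^ 2 := by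
  have h1 := hTh_norm_two hz
  have h2 := hTh_norm_two (z := 9 * z) (by simpa using hz)
  have h3 := hTh_norm_two (z := z / 9) (by simpa using hz)
  have e2 : (9 * z).re = 9 * z.re := by simp
  have e3 : (z / 9).re = z.re / 9 := by simp
  rw [e2] at h2
  rw [e3] at h3
  have : hG z = 4 * (hTh z - 1) - 3 * (hTh (9 * z) - 1) - (hTh (z / 9) - 1) := by rw [hG]; ring
  rw [this]
  have : ‖4 * (hTh z - 1) - 3 * (hTh (9 * z) - 1) - (hTh (z / 9) - 1)‖ ≤
      4 * ‖hTh z - 1‖ + 3 * ‖hTh (9 * z) - 1‖ + ‖hTh (z / 9) - 1‖ := by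
    refine (norm_sub_le _ _).trans ?_
    gcongr
    refine (norm_sub_le _ _).trans ?_
    simp
  refine this.trans ?_
  have f2 : 4 / (9 * z.re) ^ 2 = (4 / 81) * (1 / z.re ^ 2) := by field_simp; norm_num
  have f3 : 4 / (z.re / 9) ^ 2 = 324 * (1 / z.re ^ 2) := by field_simp; norm_num
  have f1 : 4 / z.re ^ 2 = 4 * (1 / z.re ^ 2) := by ring
  have f4 : 400 / z.re ^ 2 = 400 * (1 / z.re ^ 2) := by ring
  have : 0 < 1 / z.re ^ 2 := by positivity
  rw [f4]; rw [f1] at h1; rw [f2] at h2; rw [f3] at h3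
  linarith

lemma h_real_mul_cpow {a : ℝ} (ha : 0 < a) {z : ℂ} (hz : z ≠ 0) (s : ℂ) :
    ((a : ℂ) * z) ^ s = (a : ℂ) ^ s * z ^ s := by
  have ha' : (a : ℂ) ≠ 0 := by exact_mod_cast ha.ne'
  rw [cpow_def_of_ne_zero (mul_ne_zero ha' hz), cpow_def_of_ne_zero ha', cpow_def_of_ne_zero hz,
    log_ofReal_mul ha hz, ← Complex.exp_add, ← ofReal_log ha.le]
  congr 1; ring

lemma h_cpow_sq {a : ℝ} (ha : 0 < a) (z : ℂ) :
    (((a ^ 2 : ℝ) : ℂ) * z) ^ (1 / 2 : ℂ) = a * z ^ (1 / 2 : ℂ) := by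
  rcases eq_or_ne z 0 with rfl | hz
  · simp
  · rw [h_real_mul_cpow (by positivity) hz]
    congr 1
    have := ofReal_cpow (x := a ^ 2) (by positivity) (1 / 2)
    push_cast at this
    push_cast
    rw [← this, ← Real.sqrt_eq_rpow, Real.sqrt_sq ha.le]

lemma h_cpow_nine (z : ℂ) : (9 * z) ^ (1 / 2 : ℂ) = 3 * z ^ (1 / 2 : ℂ) := by
  have := h_cpow_sq (a := 3) (by norm_num) z
  norm_num at this ⊢
  exact this

lemma h_cpow_four (z : ℂ) : (4 * z) ^ (1 / 2 : ℂ) = 2 * z ^ (1 / 2 : ℂ) := by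
  have := h_cpow_sq (a := 2) (by norm_num) z
  norm_num at this ⊢
  exact this

lemma hG_inv {z : ℂ} (hz : 0 < z.re) : hG z = 1 / z ^ (1 / 2 : ℂ) * hG z⁻¹ := by
  have hz0 : z ≠ 0 := by rintro rfl; simp at hz
  have hc : z ^ (1 / 2 : ℂ) ≠ 0 := by simp [cpow_eq_zero_iff, hz0]
  rw [hG, hTh_inv hz, hTh_inv (z := 9 * z) (by simpa using hz),
    hTh_inv (z := z / 9) (by simpa using hz), h_cpow_nine, hG]
  have e : z ^ (1 / 2 : ℂ) = 3 * (z / 9) ^ (1 / 2 : ℂ) := by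
    rw [← h_cpow_nine]; congr 1; ring
  have hc' : (z / 9) ^ (1 / 2 : ℂ) ≠ 0 := by
    intro h; rw [h] at e; simp at e; simp_all
  have e1 : (9 * z)⁻¹ = z⁻¹ / 9 := by field_simp
  have e2 : (z / 9)⁻¹ = 9 * z⁻¹ := by field_simp
  rw [e1, e2, e]
  field_simp
  ring

lemma hTh_near_I {e : ℂ} (he : 0 < e.re) (h1 : ‖e‖⁻¹ ≤ 2 * (e⁻¹).re) (h2 : 1 / 18 ≤ (e⁻¹).re) :
    ‖hTh (e + I)‖ ≤ 200 := by
  have he0 : e ≠ 0 := by rintro rfl; simp at he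
  have hn : 0 < ‖e‖ := norm_pos_iff.2 he0
  have hc : e ^ (1 / 2 : ℂ) ≠ 0 := by simp [cpow_eq_zero_iff, he0]
  set u := (e⁻¹).re with hu
  have hu0 : 0 < u := by linarith
  have e1 : (4 * e)⁻¹ = e⁻¹ / 4 := by field_simp
  have key : hTh (e + I) = 1 / e ^ (1 / 2 : ℂ) * ((hTh (e⁻¹ / 4) - 1) - (hTh e⁻¹ - 1)) := by
    rw [hTh_I_add he, hTh_inv he, hTh_inv (z := 4 * e) (by simpa using he), h_cpow_four, e1]
    field_simp
    ring
  have b1 := hTh_norm_one (z := e⁻¹) hu0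
  have e3 : (e⁻¹ / 4).re = u / 4 := by simp [hu]
  have b2 := hTh_norm_one (z := e⁻¹ / 4) (by rw [e3]; linarith)
  rw [e3] at b2
  rw [← hu] at b1
  have b3 : ‖1 / e ^ (1 / 2 : ℂ)‖ ≤ 1 + ‖e‖⁻¹ := by
    have : ‖e ^ (1 / 2 : ℂ)‖ = ‖e‖ ^ (1/2 : ℝ) := by
      have := Complex.norm_cpow_real e (1/2)
      rw [← this]; norm_num
    rw [norm_div, this, norm_one, one_div, ← Real.inv_rpow hn.le]
    have h0 : 0 ≤ ‖e‖⁻¹ := by positivity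
    rw [← Real.sqrt_eq_rpow]
    rw [Real.sqrt_le_left (by positivity)]
    nlinarith
  rw [key, norm_mul]
  calc _ ≤ (1 + 2 * u) * (2 / (u / 4) + 2 / u) := by
        gcongr
        · linarith
        · exact (norm_sub_le _ _).trans (by linarith)
    _ = 10 * (1 / u) + 20 := by field_simp; ring
    _ ≤ 200 := by
      have : 1 / u ≤ 18 := by
        rw [div_le_iff₀ hu0]; linarith
      linarith

lemma hG_bdd {z : ℂ} (hz : 0 < z.re) (hi : 0 ≤ z.im) (hn : ‖z‖ = 1) : ‖hG z‖ ≤ 2000 := by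
  have hz0 : z ≠ 0 := by rintro rfl; simp at hz
  have hsq : z.re * z.re + z.im * z.im = 1 := by
    rw [← normSq_apply, normSq_eq_norm_sq, hn]; norm_num
  have him : z.im < 1 := by nlinarith
  set e := z - I with he
  have here : e.re = z.re := by simp [he]
  have heim : e.im = z.im - 1 := by simp [he]
  have hns : normSq e = 2 * (1 - z.im) := by
    rw [normSq_apply, here, heim]; linarith
  have hpos : 0 < ‖e‖ := norm_pos_iff.2 (by intro h; rw [h] at here; simp at here; linarith)
  have hu : (e⁻¹).re = z.re / (2 * (1 - z.im)) := by
    rw [inv_re, hns, here]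
  have h2 : 1 / 2 ≤ (e⁻¹).re := by
    rw [hu, le_div_iff₀ (by linarith)]
    nlinarith
  have h1 : ‖e‖⁻¹ ≤ 2 * (e⁻¹).re := by
    have hle : ‖e‖ ≤ 2 * z.re := by
      apply abs_le_of_sq_le_sq' _ (by linarith) |>.2
      rw [← normSq_eq_norm_sq, hns]; nlinarith
    rw [inv_re, here, normSq_eq_norm_sq]
    rw [inv_le_iff_one_le_mul₀ hpos]
    field_simp
    linarith
  have t1 : ‖hTh z‖ ≤ 200 := by
    have := hTh_near_I (e := e) (by rw [here]; exact hz) h1 (by linarith)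
    simpa [he] using this
  have t2 : ‖hTh (9 * z)‖ ≤ 200 := by
    have e1 : (9 * e)⁻¹ = e⁻¹ / 9 := by rw [mul_inv]; ring
    have e2 : (e⁻¹ / 9).re = (e⁻¹).re / 9 := by simp
    have := hTh_near_I (e := 9 * e) (by simp [here, hz])
      (by
        have : ‖(9 : ℂ)‖ = 9 := by norm_num
        rw [e1, e2, norm_mul, mul_inv, this]; linarith)
      (by rw [e1, e2]; linarith)
    rw [← hTh_period' 4] at this
    convert this using 3
    rw [he]; push_cast; ring
  have t3 : ‖hTh (z / 9)‖ ≤ 600 := by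
    have ez : z ^ (1 / 2 : ℂ) = 3 * (z / 9) ^ (1 / 2 : ℂ) := by
      rw [← h_cpow_nine]; congr 1; ring
    have n1 : ‖z ^ (1 / 2 : ℂ)‖ = 1 := by
      have := Complex.norm_cpow_real z (1/2)
      rw [hn, Real.one_rpow] at this
      rw [← this]; norm_num
    have n2 : ‖(z / 9) ^ (1 / 2 : ℂ)‖ = 1 / 3 := by
      rw [ez, norm_mul] at n1
      simp at n1
      simp
      linarith
    have hconj : (z / 9)⁻¹ = (starRingEnd ℂ) (9 * z) := by
      rw [inv_div, div_eq_mul_inv, inv_def, normSq_eq_norm_sq, hn]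
      have : (starRingEnd ℂ) (9 : ℂ) = 9 := by
        have := conj_ofReal 9
        simpa using this
      simp [this]
    rw [hTh_inv (by simpa using hz), hconj, hTh_conj (by simpa using hz), norm_mul, norm_div, n2,
      norm_conj]
    norm_num
    linarith
  rw [hG]
  have : ‖4 * hTh z - 3 * hTh (9 * z) - hTh (z / 9)‖ ≤
      4 * ‖hTh z‖ + 3 * ‖hTh (9 * z)‖ + ‖hTh (z / 9)‖ := by
    refine (norm_sub_le _ _).trans ?_
    gcongr
    refine (norm_sub_le _ _).trans ?_
    simp
  linarith


open scoped Real in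
lemma hTh_third {d : ℝ} (hd : 0 < d) :
    (hTh (2 / 3 * (d + I))).re ≤ (hTh (6 * d)).re := by
  have h1 := hTh_hasSum (z := 6 * (d : ℂ)) (by simpa using hd)
  have h2 := hTh_hasSum (z := 2 / 3 * ((d : ℂ) + I)) (by
    have : (2 / 3 * ((d : ℂ) + I)) = ((2 / 3 : ℝ) : ℂ) * (d + I) := by push_cast; ring
    rw [this, re_ofReal_mul]; simp; linarith)
  have hinj : Function.Injective (fun m : ℤ => 3 * m) := fun a b h => by simpa using h
  have h1' := (hasSum_extend_zero hinj).2 h1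
  refine hasSum_le ?_ (Complex.hasSum_re h2) (Complex.hasSum_re h1')
  intro n
  have key : ∀ n m : ℤ, n ^ 2 = 3 * m + 1 →
      (cexp (-π * (n : ℂ) ^ 2 * (2 / 3 * ((d : ℂ) + I)))).re ≤ 0 := by
    intro n m h
    have hc : (n : ℂ) ^ 2 = 3 * m + 1 := by exact_mod_cast h
    have : -π * (n : ℂ) ^ 2 * (2 / 3 * ((d : ℂ) + I)) =
      ((-π * (n : ℝ) ^ 2 * (2 / 3 * d) : ℝ) : ℂ) + ((-(π - π / 3) : ℝ) : ℂ) * I +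
        ((-m : ℤ) : ℂ) * (2 * π * I) := by
      push_cast
      linear_combination (-(2 / 3) * (π : ℂ) * I) * hc
    rw [this, Complex.exp_periodic.int_mul, Complex.exp_add, ← ofReal_exp, re_ofReal_mul,
      Complex.exp_ofReal_mul_I_re, Real.cos_neg, Real.cos_pi_sub, Real.cos_pi_div_three]
    have := Real.exp_pos (-π * (n : ℝ) ^ 2 * (2 / 3 * d))
    linarith
  have hcase : ∃ m : ℤ, n = 3 * m ∨ n = 3 * m + 1 ∨ n = 3 * m + 2 := ⟨n / 3, by omega⟩
  obtain ⟨m, h | h | h⟩ := hcase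
  · rw [h, hinj.extend_apply (f := fun m : ℤ => 3 * m)]
    refine le_of_eq (congrArg _ ?_)
    have : -π * ((3 * m : ℤ) : ℂ) ^ 2 * (2 / 3 * ((d : ℂ) + I)) =
      -π * (m : ℂ) ^ 2 * (6 * d) + ((-(3 * m ^ 2) : ℤ) : ℂ) * (2 * π * I) := by
      push_cast; ring
    rw [this, Complex.exp_periodic.int_mul]
  · rw [Function.extend_apply' _ _ _ (by rintro ⟨a, ha⟩; omega)]
    exact key n (3 * m ^ 2 + 2 * m) (by rw [h]; ring)
  · rw [Function.extend_apply' _ _ _ (by rintro ⟨a, ha⟩; omega)]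
    exact key n (3 * m ^ 2 + 4 * m + 1) (by rw [h]; ring)

lemma hTh_gap {a : ℝ} (ha : 0 < a) (ha' : a ≤ 1 / 24) :
    1 / (3 * √a) ≤ (hTh a).re - (hTh (9 * a)).re := by
  have hs : 0 < √a := Real.sqrt_pos.2 ha
  have hc : (a : ℂ) ^ (1 / 2 : ℂ) = (√a : ℝ) := by
    rw [Real.sqrt_eq_rpow, ofReal_cpow ha.le]; norm_num
  have i1 := hTh_inv (z := (a : ℂ)) (by simpa using ha)
  have i2 := hTh_inv (z := 9 * (a : ℂ)) (by simpa using ha)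
  rw [h_cpow_nine, hc] at i2
  rw [hc] at i1
  have b1 := hTh_norm_one (z := (a : ℂ)⁻¹) (by rw [← ofReal_inv, ofReal_re]; positivity)
  have b2 := hTh_norm_one (z := (9 * (a : ℂ))⁻¹) (by
    rw [show (9 * (a : ℂ))⁻¹ = (((9 * a)⁻¹ : ℝ) : ℂ) by push_cast; ring, ofReal_re]; positivity)
  rw [show (9 * (a : ℂ))⁻¹ = (((9 * a)⁻¹ : ℝ) : ℂ) by push_cast; ring, ofReal_re] at b2
  rw [← ofReal_inv, ofReal_re] at b1
  rw [show (9 * (a : ℂ))⁻¹ = (((9 * a)⁻¹ : ℝ) : ℂ) by push_cast; ring] at i2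
  rw [← ofReal_inv] at i1
  have c1 := (abs_le.1 ((abs_re_le_norm _).trans b1)).1
  have c2 := (abs_le.1 ((abs_re_le_norm _).trans b2)).2
  have r1 : (hTh a).re = 1 / √a * (hTh ((a⁻¹ : ℝ) : ℂ)).re := by
    rw [i1, show (1 : ℂ) / ((√a : ℝ) : ℂ) = ((1 / √a : ℝ) : ℂ) by push_cast; ring, re_ofReal_mul]
  have r2 : (hTh (9 * a)).re = 1 / √a * ((hTh (((9 * a)⁻¹ : ℝ) : ℂ)).re / 3) := by
    rw [i2, show (1 : ℂ) / (3 * ((√a : ℝ) : ℂ)) = ((1 / (3 * √a) : ℝ) : ℂ) by push_cast; ring,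
      re_ofReal_mul]
    field_simp
  rw [r1, r2, ← mul_sub, show 1 / (3 * √a) = 1 / √a * (1 / 3) by field_simp]
  rw [sub_re, one_re] at c1 c2
  have d1 : 2 / a⁻¹ = 2 * a := by field_simp
  have d2 : 2 / (9 * a)⁻¹ = 18 * a := by field_simp; norm_num
  rw [d1] at c1
  rw [d2] at c2
  gcongr
  linarith

lemma hG_unbdd (B : ℝ) : ∃ d : ℝ, 0 < d ∧ d ≤ 1 ∧ B < ‖hG (6 * (d + I))‖ := by
  let K := |B| + 24
  have hK : 24 ≤ K := by simp only [K]; linarith [abs_nonneg B]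
  have hKB : B < K := by simp only [K]; linarith [le_abs_self B]
  let a : ℝ := 1 / K ^ 2
  have ha : 0 < a := by positivity
  have ha' : a ≤ 1 / 24 := by
    apply one_div_le_one_div_of_le <;> nlinarith
  have hsa : √a = 1 / K := by
    simp only [a]
    rw [Real.sqrt_div (by norm_num), Real.sqrt_sq (by linarith)]; simp
  refine ⟨a / 6, by positivity, by linarith, ?_⟩
  have hd : 0 < a / 6 := by positivity
  have t1 : hTh (6 * (((a / 6 : ℝ) : ℂ) + I)) = hTh a := by
    rw [← hTh_period' 3 a]; congr 1; push_cast; ring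
  have t2 : hTh (9 * (6 * (((a / 6 : ℝ) : ℂ) + I))) = hTh (9 * a) := by
    rw [← hTh_period' 27 (9 * a)]; congr 1; push_cast; ring
  have t3 := hTh_third hd
  rw [show (6 : ℂ) * ((a / 6 : ℝ) : ℂ) = a by push_cast; ring] at t3
  have gap := hTh_gap ha ha'
  rw [hsa] at gap
  have e3 : 6 * (((a / 6 : ℝ) : ℂ) + I) / 9 = 2 / 3 * (((a / 6 : ℝ) : ℂ) + I) := by ring
  have hre : (hG (6 * (((a / 6 : ℝ) : ℂ) + I))).re =
      4 * (hTh a).re - 3 * (hTh (9 * a)).re - (hTh (2 / 3 * (((a / 6 : ℝ) : ℂ) + I))).re := by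
    rw [hG, t1, t2, e3]; simp
  have : K ≤ (hG (6 * (((a / 6 : ℝ) : ℂ) + I))).re := by
    rw [hre]
    have : 1 / (3 * (1 / K)) = K / 3 := by field_simp
    rw [this] at gap
    linarith
  exact hKB.trans_le (this.trans (re_le_norm _))


lemma hTh_contOn {w : ℂ} (hw : 0 < w.re) :
    ContinuousOn (fun x : ℝ => hTh (w * x)) (Set.Ioi 0) := by
  intro x hx
  have hx' : 0 < x := hx
  refine ContinuousAt.continuousWithinAt ?_
  have h : ContinuousAt hTh (w * x) := hTh_continuousAt (by simp; positivity)
  exact ContinuousAt.comp (f := fun x : ℝ => w * (x : ℂ)) (g := hTh) h (by fun_prop)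

lemma h_nine_re {w : ℂ} (hw : 0 < w.re) : 0 < (9 * w).re := by simpa using hw
lemma h_ninth_re {w : ℂ} (hw : 0 < w.re) : 0 < (w / 9).re := by simpa using hw

lemma hG_eq (w : ℂ) (x : ℝ) : hG (w * x) =
    4 * (hTh (w * x) - 1) - 3 * (hTh (9 * w * x) - 1) - (hTh (w / 9 * x) - 1) := by
  rw [hG, mul_assoc, show w * (x : ℂ) / 9 = w / 9 * x by ring]; ring

lemma hG_contOn {w : ℂ} (hw : 0 < w.re) :
    ContinuousOn (fun x : ℝ => hG (w * x)) (Set.Ioi 0) := by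
  simp_rw [hG_eq]
  have h1 := hTh_contOn hw
  have h2 := hTh_contOn (h_nine_re hw)
  have h3 := hTh_contOn (h_ninth_re hw)
  fun_prop

lemma hG_locInt {w : ℂ} (hw : 0 < w.re) :
    MeasureTheory.LocallyIntegrableOn (fun x : ℝ => hG (w * x)) (Set.Ioi 0) :=
  (hG_contOn hw).locallyIntegrableOn measurableSet_Ioi

lemma hG_top {w : ℂ} (hw : 0 < w.re) :
    (fun x : ℝ => hG (w * x)) =O[Filter.atTop] (fun x : ℝ => x ^ (-2 : ℝ)) := by
  refine Asymptotics.IsBigO.of_bound (400 / w.re ^ 2) ?_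
  filter_upwards [Filter.eventually_gt_atTop 0] with x hx
  have := hG_norm (z := w * x) (by simp; positivity)
  refine this.trans (le_of_eq ?_)
  rw [Real.rpow_neg hx.le, Real.norm_of_nonneg (by positivity)]
  simp
  field_simp

lemma hG_bot {w : ℂ} (hw : 0 < w.re) :
    (fun x : ℝ => hG (w * x)) =O[nhdsWithin 0 (Set.Ioi 0)] (fun x : ℝ => x ^ (-0 : ℝ)) := by
  have hw0 : w ≠ 0 := by rintro rfl; simp at hw
  have hnw : 0 < ‖w‖ := norm_pos_iff.2 hw0
  refine Asymptotics.IsBigO.of_bound (400 * ‖w‖ ^ 4 / w.re ^ 2 * (1 + ‖w‖⁻¹)) ?_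
  filter_upwards [Ioo_mem_nhdsGT (show (0:ℝ) < 1 by norm_num)] with x hx
  obtain ⟨hx, hx1⟩ := hx
  have hre : 0 < (w * x).re := by simp; positivity
  rw [hG_inv hre]
  have hr : ((w * x)⁻¹).re = w.re / (‖w‖ ^ 2 * x) := by
    rw [inv_re, normSq_eq_norm_sq, norm_mul, norm_real, Real.norm_of_nonneg hx.le]
    simp
    field_simp
  have b := hG_norm (z := (w * x)⁻¹) (by rw [hr]; positivity)
  rw [hr] at b
  have n1 : ‖1 / (w * x) ^ (1 / 2 : ℂ)‖ ≤ 1 + (‖w‖ * x)⁻¹ := by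
    have h1 := Complex.norm_cpow_real (w * x) (1/2)
    have h2 : ‖w * (x : ℂ)‖ = ‖w‖ * x := by rw [norm_mul, norm_real, Real.norm_of_nonneg hx.le]
    rw [h2] at h1
    push_cast at h1
    rw [norm_div, h1, norm_one, one_div, ← Real.inv_rpow (by positivity)]
    have h0 : 0 ≤ (‖w‖ * x)⁻¹ := by positivity
    rw [← Real.sqrt_eq_rpow]
    rw [Real.sqrt_le_left (by positivity)]
    nlinarith
  rw [norm_mul]
  simp only [neg_zero, Real.rpow_zero, norm_one, mul_one]
  calc _ ≤ (1 + (‖w‖ * x)⁻¹) * (400 / (w.re / (‖w‖ ^ 2 * x)) ^ 2) := by gcongr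
    _ = 400 * ‖w‖ ^ 4 / w.re ^ 2 * ((x + ‖w‖⁻¹) * x) := by field_simp
    _ ≤ 400 * ‖w‖ ^ 4 / w.re ^ 2 * ((1 + ‖w‖⁻¹) * 1) := by gcongr
    _ = _ := by ring

/-- Mellin transform of rotated `hG`. -/
noncomputable def hM (w s : ℂ) : ℂ := mellin (fun x : ℝ => hG (w * x)) s

lemma hM_conv {w s : ℂ} (hw : 0 < w.re) (hs : 0 < s.re) (hs' : s.re < 2) :
    MellinConvergent (fun x : ℝ => hG (w * x)) s :=
  mellinConvergent_of_isBigO_rpow (hG_locInt hw) (hG_top hw) hs' (hG_bot hw) hs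

lemma hM_diff {w s : ℂ} (hw : 0 < w.re) (hs : 0 < s.re) (hs' : s.re < 2) :
    DifferentiableAt ℂ (hM w) s :=
  mellin_differentiableAt_of_isBigO_rpow (hG_locInt hw) (hG_top hw) hs' (hG_bot hw) hs

lemma hTh_conv {w s : ℂ} (hw : 0 < w.re) (hs : 1 < s.re) (hs' : s.re < 2) :
    MellinConvergent (fun x : ℝ => hTh (w * x) - 1) s := by
  refine mellinConvergent_of_isBigO_rpow (a := 2) (b := 1) ?_ ?_ hs' ?_ hs
  · exact ((hTh_contOn hw).sub continuousOn_const).locallyIntegrableOn measurableSet_Ioi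
  · refine Asymptotics.IsBigO.of_bound (4 / w.re ^ 2) ?_
    filter_upwards [Filter.eventually_gt_atTop 0] with x hx
    have := hTh_norm_two (z := w * x) (by simp; positivity)
    refine this.trans (le_of_eq ?_)
    rw [Real.rpow_neg hx.le, Real.norm_of_nonneg (by positivity)]
    simp
    field_simp
  · refine Asymptotics.IsBigO.of_bound (2 / w.re) ?_
    filter_upwards [self_mem_nhdsWithin] with x hx
    have hx : 0 < x := hx
    have := hTh_norm_one (z := w * x) (by simp; positivity)
    refine this.trans (le_of_eq ?_)
    rw [Real.rpow_neg hx.le, Real.norm_of_nonneg (by positivity)]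
    simp
    field_simp

lemma h_exp_norm {r s : ℂ} {x : ℝ} (hx : x ∈ Set.Ioi (0:ℝ)) :
    ‖(x : ℂ) ^ (s - 1) * cexp (-(r * x))‖ = x ^ (s.re - 1) * Real.exp (-(r.re * x)) := by
  rw [norm_mul, norm_cpow_eq_rpow_re_of_pos hx, norm_exp]
  simp

lemma h_exp_integrable {r s : ℂ} (hr : 0 < r.re) (hs : 0 < s.re) :
    MeasureTheory.IntegrableOn (fun x : ℝ => (x : ℂ) ^ (s - 1) * cexp (-(r * x))) (Set.Ioi 0) := by
  have h := integrableOn_rpow_mul_exp_neg_mul_rpow (s := s.re - 1) (p := 1) (b := r.re)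
    (by linarith) one_pos hr
  refine MeasureTheory.Integrable.mono' h ?_ ?_
  · refine ContinuousOn.aestronglyMeasurable ?_ measurableSet_Ioi
    refine ContinuousOn.mul ?_ (by fun_prop)
    intro x hx
    refine ContinuousAt.continuousWithinAt ?_
    exact continuousAt_ofReal_cpow_const _ _ (Or.inr (ne_of_gt hx))
  · filter_upwards [MeasureTheory.ae_restrict_mem measurableSet_Ioi] with x hx
    rw [h_exp_norm hx]
    simp

lemma h_exp_deriv {r s : ℂ} (hr : 0 < r.re) (hs : 0 < s.re) :
    DifferentiableAt ℂ
      (fun r : ℂ => ∫ x in Set.Ioi (0:ℝ), (x : ℂ) ^ (s - 1) * cexp (-(r * x))) r := by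
  have hb := integrableOn_rpow_mul_exp_neg_mul_rpow (s := s.re) (p := 1) (b := r.re / 2)
    (by linarith) one_pos (by linarith)
  have hmem : {r' : ℂ | r.re / 2 < r'.re} ∈ nhds r :=
    (isOpen_lt continuous_const continuous_re).mem_nhds (by simp; linarith)
  refine (hasDerivAt_integral_of_dominated_loc_of_deriv_le (𝕜 := ℂ)
    (s := {r' : ℂ | r.re / 2 < r'.re})
    (F := fun (r : ℂ) (x : ℝ) => (x : ℂ) ^ (s - 1) * cexp (-(r * x)))
    (F' := fun (r : ℂ) (x : ℝ) => (x : ℂ) ^ (s - 1) * (cexp (-(r * x)) * (-x)))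
    (bound := fun x : ℝ => x ^ s.re * Real.exp (-(r.re / 2) * x ^ (1:ℝ)))
    hmem ?_ (h_exp_integrable hr hs) ?_ ?_ hb ?_).2.differentiableAt
  · filter_upwards [hmem] with r' hr'
    exact (h_exp_integrable (lt_trans (by linarith) hr') hs).aestronglyMeasurable
  · have h := (h_exp_integrable hr hs).aestronglyMeasurable
    have h2 : MeasureTheory.AEStronglyMeasurable (fun x : ℝ => -(x : ℂ))
      (MeasureTheory.volume.restrict (Set.Ioi 0)) := by
      exact (by fun_prop : Continuous fun x : ℝ => -(x : ℂ)).aestronglyMeasurable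
    have := h.mul h2
    simp only [← mul_assoc]
    exact this
  · filter_upwards [MeasureTheory.ae_restrict_mem measurableSet_Ioi] with x hx r' hr'
    have hx0 : 0 < x := hx
    rw [← mul_assoc, norm_mul, h_exp_norm hx, norm_neg, norm_real, Real.norm_of_nonneg hx0.le,
      mul_right_comm]
    have : x ^ (s.re - 1) * x = x ^ s.re := by
      rw [← Real.rpow_add_one hx0.ne']; simp
    rw [this, Real.rpow_one]
    have hr' : r.re / 2 < r'.re := hr'
    gcongr
    nlinarith
  · filter_upwards with x r' hr'
    refine HasDerivAt.const_mul _ ?_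
    refine HasDerivAt.cexp ?_
    have h := ((hasDerivAt_id r').mul_const (x : ℂ)).neg
    rw [one_mul] at h
    exact h

lemma h_exp_integral {r s : ℂ} (hs : 0 < s.re) (hr : 0 < r.re) :
    ∫ x in Set.Ioi (0:ℝ), (x : ℂ) ^ (s - 1) * cexp (-(r * x)) = (1 / r) ^ s * Gamma s := by
  have hopen : IsOpen {r : ℂ | 0 < r.re} := isOpen_lt continuous_const continuous_re
  have hpc : IsPreconnected {r : ℂ | 0 < r.re} := (convex_halfSpace_re_gt 0).isPreconnected
  have a1 : AnalyticOnNhd ℂ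
      (fun r : ℂ => ∫ x in Set.Ioi (0:ℝ), (x : ℂ) ^ (s - 1) * cexp (-(r * x)))
      {r : ℂ | 0 < r.re} :=
    DifferentiableOn.analyticOnNhd (fun r hr => (h_exp_deriv hr hs).differentiableWithinAt) hopen
  have a2 : AnalyticOnNhd ℂ (fun r : ℂ => (1 / r) ^ s * Gamma s) {r : ℂ | 0 < r.re} := by
    refine DifferentiableOn.analyticOnNhd (fun r hr => ?_) hopen
    have hr : 0 < r.re := hr
    have hr0 : r ≠ 0 := by rintro rfl; simp at hr
    refine DifferentiableAt.differentiableWithinAt ?_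
    refine DifferentiableAt.mul_const ?_ _
    refine DifferentiableAt.cpow_const ?_ ?_
    · fun_prop (disch := exact hr0)
    · left
      rw [one_div, inv_re]
      have := normSq_pos.2 hr0
      positivity
  refine a1.eqOn_of_preconnected_of_frequently_eq a2 hpc (z₀ := 1) (by simp) ?_ hr
  have ht : Filter.Tendsto (fun x : ℝ => (x : ℂ)) (nhdsWithin 1 {1}ᶜ) (nhdsWithin 1 {1}ᶜ) := by
    refine tendsto_nhdsWithin_of_tendsto_nhds_of_eventually_within _ ?_ ?_
    · have : Continuous (fun x : ℝ => (x : ℂ)) := continuous_ofReal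
      simpa using (this.tendsto 1).mono_left nhdsWithin_le_nhds
    · filter_upwards [self_mem_nhdsWithin] with x hx
      simpa using hx
  refine ht.frequently (Filter.Eventually.frequently ?_)
  have : ∀ᶠ x : ℝ in nhdsWithin 1 {1}ᶜ, 0 < x :=
    nhdsWithin_le_nhds (lt_mem_nhds (by norm_num : (0:ℝ) < 1))
  filter_upwards [this] with x hx
  exact integral_cpow_mul_exp_neg_mul_Ioi hs hx

open scoped Real in
lemma hTh_mellin {w s : ℂ} (hw : 0 < w.re) (hs : 1 < s.re) :
    mellin (fun x : ℝ => hTh (w * x) - 1) s = 2 * (w ^ (-s) * completedRiemannZeta (2 * s)) := by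
  have hw0 : w ≠ 0 := by rintro rfl; simp at hw
  let F : ℕ → ℝ → ℂ := fun n x => (x : ℂ) ^ (s - 1) * cexp (-((π * ((n : ℂ) + 1) ^ 2 * w) * x))
  have hre : ∀ n : ℕ, (π * ((n : ℂ) + 1) ^ 2 * w).re = π * ((n : ℝ) + 1) ^ 2 * w.re := by
    intro n
    rw [show (π * ((n : ℂ) + 1) ^ 2 * w) = ((π * ((n : ℝ) + 1) ^ 2 : ℝ) : ℂ) * w by push_cast; ring,
      re_ofReal_mul]
  have hpos : ∀ n : ℕ, 0 < (π * ((n : ℂ) + 1) ^ 2 * w).re := by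
    intro n; rw [hre]; positivity
  have hint : ∀ n, MeasureTheory.Integrable (F n) (MeasureTheory.volume.restrict (Set.Ioi 0)) :=
    fun n => h_exp_integrable (hpos n) (by linarith)
  have hnorm : ∀ n, ∫ x in Set.Ioi (0:ℝ), ‖F n x‖ =
      (1 / (π * w.re)) ^ s.re * Real.Gamma s.re * (1 / ((n : ℝ) + 1) ^ (2 * s.re)) := by
    intro n
    rw [MeasureTheory.setIntegral_congr_fun measurableSet_Ioi (fun x hx => h_exp_norm hx),
      Real.integral_rpow_mul_exp_neg_mul_Ioi (by linarith) (hpos n), hre,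
      show 1 / (π * ((n : ℝ) + 1) ^ 2 * w.re) = (1 / (π * w.re)) * (1 / ((n : ℝ) + 1) ^ 2) by
        field_simp, Real.mul_rpow (by positivity) (by positivity), 
        Real.div_rpow (x := 1) (y := ((n : ℝ) + 1) ^ 2) (by norm_num) (by positivity),
        Real.rpow_mul (by positivity), Real.one_rpow, Real.rpow_two]
    ring
  have hsum : Summable fun n => ∫ x in Set.Ioi (0:ℝ), ‖F n x‖ := by
    simp_rw [hnorm]
    refine Summable.mul_left _ ?_
    have := (Real.summable_one_div_nat_rpow (p := 2 * s.re)).2 (by linarith)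
    have := (summable_nat_add_iff 1).2 this
    simpa using this
  have key := MeasureTheory.hasSum_integral_of_summable_integral_norm hint hsum
  have lhs : ∫ x in Set.Ioi (0:ℝ), ∑' n, F n x = mellin (fun x : ℝ => hTh (w * x) - 1) s / 2 := by
    rw [mellin, ← MeasureTheory.integral_div]
    refine MeasureTheory.setIntegral_congr_fun measurableSet_Ioi (fun x hx => ?_)
    have hx : 0 < x := hx
    have := hTh_nat_hasSum (z := w * x) (by simp; positivity)
    have := (this.mul_left ((x : ℂ) ^ (s - 1))).tsum_eq
    simp only [F, smul_eq_mul]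
    rw [mul_div_assoc, ← this]
    refine tsum_congr fun n => ?_
    congr 2; ring
  have hterm : ∀ n, ∫ x in Set.Ioi (0:ℝ), F n x =
      w ^ (-s) * ((π : ℂ) ^ (-s) * Gamma s * (1 / ((n : ℂ) + 1) ^ (2 * s))) := by
    intro n
    simp only [F]
    rw [h_exp_integral (by linarith) (hpos n)]
    have ha : (1 / (π * ((n : ℂ) + 1) ^ 2 * w)) ^ s = (π * ((n : ℂ) + 1) ^ 2 * w) ^ (-s) := by
      rw [one_div, inv_cpow, cpow_neg]
      intro h
      have := (Complex.abs_arg_lt_pi_div_two_iff).2 (Or.inl (hpos n))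
      rw [h, abs_of_pos Real.pi_pos] at this
      linarith [Real.pi_pos]
    have hb : (π * ((n : ℂ) + 1) ^ 2 * w) ^ (-s) =
        (π : ℂ) ^ (-s) * (1 / ((n : ℂ) + 1) ^ (2 * s)) * w ^ (-s) := by
      have e1 := h_real_mul_cpow (a := π * ((n : ℝ) + 1) ^ 2) (by positivity) hw0 (-s)
      have e2 := mul_cpow_ofReal_nonneg (a := π) (b := ((n : ℝ) + 1) ^ 2) (by positivity)
        (by positivity) (-s)
      push_cast at e1 e2
      rw [e1, e2]
      congr 2
      have e3 := mul_cpow_ofReal_nonneg (a := (n : ℝ) + 1) (b := (n : ℝ) + 1) (by positivity)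
        (by positivity) (-s)
      push_cast at e3
      have hn : (n : ℂ) + 1 ≠ 0 := by exact_mod_cast Nat.succ_ne_zero n
      rw [sq, e3, ← cpow_add _ _ hn, one_div, ← cpow_neg]
      congr 1; ring
    rw [ha, hb]; ring
  have h2 : ∑' n : ℕ, 1 / ((n : ℂ) + 1) ^ (2 * s) = riemannZeta (2 * s) := by
    rw [zeta_eq_tsum_one_div_nat_add_one_cpow (by simp; linarith)]
  have h3 := key.tsum_eq
  rw [lhs] at h3
  simp_rw [hterm] at h3
  rw [tsum_mul_left, tsum_mul_left, h2] at h3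
  have hs0 : s ≠ 0 := by rintro rfl; simp at hs; linarith
  have h4 : completedRiemannZeta (2 * s) = (π : ℂ) ^ (-s) * Gamma s * riemannZeta (2 * s) := by
    have hg : Gammaℝ (2 * s) ≠ 0 := Gammaℝ_ne_zero_of_re_pos (by simp; linarith)
    rw [riemannZeta_def_of_ne_zero (by simpa using hs0), Gammaℝ_def] 
    rw [Gammaℝ_def] at hg
    have e : -(2 * s) / 2 = -s := by ring
    have e' : 2 * s / 2 = s := by ring
    rw [e, e'] at hg ⊢
    rw [mul_div_cancel₀ _ hg]
  rw [h4]
  linear_combination (-2) * h3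


/-- The explicit Mellin transform. -/
noncomputable def hL (s : ℂ) : ℂ :=
  2 * ((4 - 3 * (9 : ℂ) ^ (-s) - (9 : ℂ) ^ s) * completedRiemannZeta (2 * s))

lemma hM_eq_right {w s : ℂ} (hw : 0 < w.re) (hs : 1 < s.re) (hs' : s.re < 2) :
    hM w s = w ^ (-s) * hL s := by
  have hw0 : w ≠ 0 := by rintro rfl; simp at hw
  have c1 := hTh_conv hw hs hs'
  have c2 := hTh_conv (h_nine_re hw) hs hs'
  have c3 := hTh_conv (h_ninth_re hw) hs hs'
  have m := (hasMellin_sub (hasMellin_sub (c1.const_smul (4 : ℂ)) (c2.const_smul (3 : ℂ))).1 c3).2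
  rw [(hasMellin_sub (c1.const_smul (4 : ℂ)) (c2.const_smul (3 : ℂ))).2,
    mellin_const_smul, mellin_const_smul, hTh_mellin hw hs, hTh_mellin (h_nine_re hw) hs,
    hTh_mellin (h_ninth_re hw) hs] at m
  rw [hM, hL]
  simp_rw [hG_eq]
  simp only [smul_eq_mul] at m
  rw [m]
  have e1 : (9 * w) ^ (-s) = 9 ^ (-s) * w ^ (-s) := by
    have := h_real_mul_cpow (a := 9) (by norm_num) hw0 (-s)
    simpa using this
  have e2 : (w / 9) ^ (-s) = 9 ^ s * w ^ (-s) := by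
    have := h_real_mul_cpow (a := 9) (by norm_num) (z := w / 9) (by simpa using hw0) (-s)
    have h9 : (9 : ℂ) * (w / 9) = w := by ring
    push_cast at this
    rw [h9, cpow_neg 9] at this
    have : (9 : ℂ) ^ s ≠ 0 := by simp [cpow_eq_zero_iff]
    rw [‹w ^ (-s) = _›]
    field_simp
  rw [e1, e2]
  ring

lemma hM_eq {w s : ℂ} (hw : 0 < w.re) (hs : 0 < s.re) (hs' : s.re < 2) (hs2 : s ≠ 1 / 2) :
    hM w s = w ^ (-s) * hL s := by
  have hw0 : w ≠ 0 := by rintro rfl; simp at hw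
  let P : ℂ → ℂ := fun s => 2 * s * (1 - 2 * s) * completedRiemannZeta₀ (2 * s) - (1 - 2 * s) - 2 * s
  have hP : ∀ s : ℂ, s ≠ 0 → s ≠ 1 / 2 → P s = 2 * s * (1 - 2 * s) * completedRiemannZeta (2 * s) := by
    intro s h0 h1
    have h1' : 1 - 2 * s ≠ 0 := by
      intro h; apply h1; linear_combination (-1/2 : ℂ) * h
    simp only [P]
    rw [completedRiemannZeta_eq]
    field_simp
  let f : ℂ → ℂ := fun s => 2 * s * (1 - 2 * s) * hM w s
  let g : ℂ → ℂ := fun s => w ^ (-s) * (2 * ((4 - 3 * (9 : ℂ) ^ (-s) - (9 : ℂ) ^ s) * P s))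
  let U : Set ℂ := {s : ℂ | 0 < s.re} ∩ {s : ℂ | s.re < 2}
  have hU : IsOpen U :=
    (isOpen_lt continuous_const continuous_re).inter (isOpen_lt continuous_re continuous_const)
  have hUc : IsPreconnected U :=
    ((convex_halfSpace_re_gt 0).inter (convex_halfSpace_re_lt 2)).isPreconnected
  have hf : AnalyticOnNhd ℂ f U := by
    refine DifferentiableOn.analyticOnNhd (fun r hr => ?_) hU
    refine DifferentiableAt.differentiableWithinAt ?_
    have := hM_diff hw hr.1 hr.2
    simp only [f]
    fun_prop
  have hPd : Differentiable ℂ P := by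
    have : Differentiable ℂ (fun s : ℂ => completedRiemannZeta₀ (2 * s)) :=
      differentiable_completedZeta₀.comp (by fun_prop)
    simp only [P]
    fun_prop
  have hg : AnalyticOnNhd ℂ g U := by
    refine DifferentiableOn.analyticOnNhd (fun r hr => ?_) hU
    refine DifferentiableAt.differentiableWithinAt ?_
    have d1 : DifferentiableAt ℂ (fun s : ℂ => w ^ (-s)) r :=
      DifferentiableAt.const_cpow (by fun_prop) (Or.inl hw0)
    have d2 : DifferentiableAt ℂ (fun s : ℂ => (9 : ℂ) ^ (-s)) r :=
      DifferentiableAt.const_cpow (by fun_prop) (Or.inl (by norm_num))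
    have d3 : DifferentiableAt ℂ (fun s : ℂ => (9 : ℂ) ^ s) r :=
      DifferentiableAt.const_cpow (by fun_prop) (Or.inl (by norm_num))
    have d4 := hPd r
    simp only [g]
    fun_prop
  have hfg : Set.EqOn f g U := by
    refine hf.eqOn_of_preconnected_of_eventuallyEq hg hUc (z₀ := 3 / 2)
      ⟨by simp, by simp; norm_num⟩ ?_
    have o1 : {s : ℂ | 1 < s.re} ∈ nhds (3 / 2 : ℂ) :=
      (isOpen_lt continuous_const continuous_re).mem_nhds (by simp; norm_num)
    have o2 : {s : ℂ | s.re < 2} ∈ nhds (3 / 2 : ℂ) :=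
      (isOpen_lt continuous_re continuous_const).mem_nhds (by simp; norm_num)
    filter_upwards [o1, o2] with z h1 h2
    have h1 : 1 < z.re := h1
    simp only [f, g]
    rw [hM_eq_right hw h1 h2, hP z (by rintro rfl; simp at h1; linarith)
      (by rintro rfl; norm_num at h1), hL]
    ring
  have h0 : s ≠ 0 := by rintro rfl; simp at hs
  have key := hfg (show s ∈ U from ⟨hs, hs'⟩)
  simp only [f, g] at key
  rw [hP s h0 hs2] at key
  have hne : 2 * s * (1 - 2 * s) ≠ 0 := by
    refine mul_ne_zero (by simpa using h0) ?_
    intro h; apply hs2; linear_combination (-1/2 : ℂ) * h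
  apply mul_left_cancel₀ hne
  rw [key, hL]; ring

/-- restriction to the critical line -/
noncomputable def hR (y : ℝ) : ℂ := hM 1 (((1 / 4 : ℝ) : ℂ) + y * I)

lemma h_line_re (y : ℝ) : ((((1 / 4 : ℝ) : ℂ) + y * I)).re = 1 / 4 := by simp
lemma h_line_im (y : ℝ) : ((((1 / 4 : ℝ) : ℂ) + y * I)).im = y := by simp

lemma h_line_ne (y : ℝ) : (((1 / 4 : ℝ) : ℂ) + y * I) ≠ 1 / 2 := by
  intro h
  have := congrArg re h
  rw [h_line_re] at this
  norm_num at this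

lemma hR_eq (y : ℝ) : hR y = hL (((1 / 4 : ℝ) : ℂ) + y * I) := by
  rw [hR, hM_eq (by simp) (by rw [h_line_re]; norm_num) (by rw [h_line_re]; norm_num) (h_line_ne y)]
  simp

lemma hM_line {w : ℂ} (hw : 0 < w.re) (y : ℝ) :
    hM w (((1 / 4 : ℝ) : ℂ) + y * I) = w ^ (-(((1 / 4 : ℝ) : ℂ) + y * I)) * hR y := by
  rw [hR_eq, hM_eq hw (by rw [h_line_re]; norm_num) (by rw [h_line_re]; norm_num) (h_line_ne y)]

lemma h_cpow_norm {w : ℂ} (hw : 0 < w.re) (y : ℝ) :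
    ‖w ^ (-(((1 / 4 : ℝ) : ℂ) + y * I))‖ = ‖w‖ ^ (-(1 / 4) : ℝ) * Real.exp (y * arg w) := by
  have hw0 : w ≠ 0 := by rintro rfl; simp at hw
  rw [norm_cpow_of_ne_zero hw0, neg_re, neg_im, h_line_re, h_line_im, div_eq_mul_inv,
    ← Real.exp_neg]
  congr 2; ring

lemma hR_cont : Continuous hR := by
  rw [continuous_iff_continuousAt]
  intro y
  have h := (hM_diff (w := 1) (s := ((1 / 4 : ℝ) : ℂ) + y * I) (by simp)
    (by rw [h_line_re]; norm_num) (by rw [h_line_re]; norm_num)).continuousAt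
  exact ContinuousAt.comp (f := fun y : ℝ => ((1 / 4 : ℝ) : ℂ) + y * I) (g := hM 1) h (by fun_prop)

lemma hR_real (y : ℝ) : (hR y).im = 0 := by
  rw [← conj_eq_iff_im]
  have h1 : (starRingEnd ℂ) (hR y) = hR (-y) := by
    rw [hR, hR, hM, hM, mellin, mellin, ← integral_conj]
    refine MeasureTheory.setIntegral_congr_fun measurableSet_Ioi (fun x hx => ?_)
    have hx : 0 < x := hx
    have c9 : (starRingEnd ℂ) (9 : ℂ) = 9 := by
      have := conj_ofReal 9
      simpa using this
    have c3 : (starRingEnd ℂ) (3 : ℂ) = 3 := by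
      have := conj_ofReal 3
      simpa using this
    have c4 : (starRingEnd ℂ) (4 : ℂ) = 4 := by
      have := conj_ofReal 4
      simpa using this
    simp only [smul_eq_mul, map_mul]
    congr 1
    · have key := cpow_conj (x : ℂ) (((1 / 4 : ℝ) : ℂ) + y * I - 1)
        (by rw [arg_ofReal_of_nonneg hx.le]; exact Real.pi_pos.ne)
      rw [conj_ofReal] at key
      rw [← key]
      congr 1
      rw [map_sub, map_add, map_mul, conj_ofReal, conj_ofReal, conj_I, map_one]
      push_cast
      ring
    · have t : ∀ z : ℂ, 0 < z.re → (starRingEnd ℂ) z = z → (starRingEnd ℂ) (hTh z) = hTh z := by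
        intro z hz hc
        rw [← hTh_conj hz, hc]
      rw [hG]
      simp only [map_sub, map_mul, c3, c4]
      rw [t, t, t] <;> simp [c9, hx]
  rw [h1, hR_eq, hR_eq, hL, hL]
  have e1 : ((1 / 4 : ℝ) : ℂ) + ((-y : ℝ) : ℂ) * I = 1 / 2 - (((1 / 4 : ℝ) : ℂ) + y * I) := by
    push_cast; ring
  rw [e1]
  generalize (((1 / 4 : ℝ) : ℂ) + y * I) = s
  have e2 : 2 * (1 / 2 - s) = 1 - 2 * s := by ring
  rw [e2, completedRiemannZeta_one_sub]
  have h9 : (9 : ℂ) ^ (1 / 2 : ℂ) = 3 := by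
    have := h_cpow_nine 1
    simpa using this
  have n9 : (9 : ℂ) ≠ 0 := by norm_num
  have e3 : (9 : ℂ) ^ (1 / 2 - s) = 3 * 9 ^ (-s) := by
    rw [sub_eq_add_neg, cpow_add _ _ n9, h9]
  have e4 : 3 * (9 : ℂ) ^ (-(1 / 2 - s)) = 9 ^ s := by
    rw [← h9, ← cpow_add _ _ n9]; congr 1; ring
  rw [e3, e4]; ring

lemma hR_ne {y : ℝ} (h : riemannZeta (1 / 2 + ((2 * y : ℝ) : ℂ) * I) ≠ 0) : hR y ≠ 0 := by
  rw [hR_eq, hL]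
  have e : 2 * (((1 / 4 : ℝ) : ℂ) + y * I) = 1 / 2 + ((2 * y : ℝ) : ℂ) * I := by push_cast; ring
  rw [e]
  have hne : (1 / 2 + ((2 * y : ℝ) : ℂ) * I) ≠ 0 := by
    intro h
    have := congrArg re h
    simp at this
  refine mul_ne_zero (by norm_num) (mul_ne_zero ?_ ?_)
  · intro h0
    have n : ∀ s : ℂ, ‖(9 : ℂ) ^ s‖ = 9 ^ s.re := by
      intro s
      have := norm_cpow_eq_rpow_re_of_pos (x := 9) (by norm_num) s
      simpa using this
    have h1 : (4 : ℂ) = 3 * 9 ^ (-(((1 / 4 : ℝ) : ℂ) + y * I)) + 9 ^ (((1 / 4 : ℝ) : ℂ) + y * I) := by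
      linear_combination h0
    have h2 := congrArg norm h1
    have h3 := norm_add_le (3 * (9 : ℂ) ^ (-(((1 / 4 : ℝ) : ℂ) + y * I)))
      (9 ^ (((1 / 4 : ℝ) : ℂ) + y * I))
    rw [← h2, norm_mul, n, n, neg_re, h_line_re] at h3
    have e9 : (9 : ℝ) ^ (1 / 4 : ℝ) = √3 := by
      rw [Real.sqrt_eq_rpow, show (9 : ℝ) = 3 ^ (2 : ℝ) by norm_num, ← Real.rpow_mul (by norm_num)]
      norm_num
    rw [Real.rpow_neg (by norm_num), e9] at h3
    have s3 : √3 * √3 = 3 := Real.mul_self_sqrt (by norm_num)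
    have p3 : 0 < √3 := by positivity
    have : 3 * (√3)⁻¹ = √3 := by field_simp; nlinarith
    norm_num at h3
    nlinarith
  · intro h0
    apply h
    rw [riemannZeta_def_of_ne_zero hne, h0, zero_div]


lemma hw_re {φ : ℝ} (h1 : -(Real.pi / 2) < φ) (h2 : φ < Real.pi / 2) : 0 < (exp (φ * I)).re := by
  rw [exp_ofReal_mul_I_re]
  exact Real.cos_pos_of_mem_Ioo ⟨h1, h2⟩

lemma hw_arg {φ : ℝ} (h1 : -(Real.pi / 2) < φ) (h2 : φ < Real.pi / 2) :
    arg (exp (φ * I)) = φ := by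
  rw [arg_exp_mul_I, toIocMod_eq_self]
  constructor <;> linarith [Real.pi_pos]

lemma hR_bound {φ : ℝ} (h1 : -(Real.pi / 2) < φ) (h2 : φ < Real.pi / 2) :
    ∃ C, ∀ y, ‖hR y‖ * Real.exp (y * φ) ≤ C := by
  refine ⟨∫ x in Set.Ioi (0 : ℝ), ‖((x : ℂ) ^ (((1 / 4 : ℝ) : ℂ) - 1)) • hG (exp (φ * I) * x)‖, ?_⟩
  intro y
  have hw := hw_re h1 h2
  have e : ‖hM (exp (φ * I)) (((1 / 4 : ℝ) : ℂ) + y * I)‖ = ‖hR y‖ * Real.exp (y * φ) := by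
    rw [hM_line hw, norm_mul, h_cpow_norm hw, hw_arg h1 h2, norm_exp_ofReal_mul_I]
    simp
    ring
  rw [← e, hM, mellin]
  refine (MeasureTheory.norm_integral_le_integral_norm _).trans (le_of_eq ?_)
  refine MeasureTheory.setIntegral_congr_fun measurableSet_Ioi (fun x hx => ?_)
  have hx : 0 < x := hx
  simp only [norm_smul]
  rw [norm_cpow_eq_rpow_re_of_pos hx, norm_cpow_eq_rpow_re_of_pos hx]
  simp

lemma h_exp_int {η : ℝ} (hη : 0 < η) :
    MeasureTheory.Integrable (fun y : ℝ => Real.exp (-η * |y|)) := by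
  rw [← MeasureTheory.integrableOn_univ, ← Set.Iic_union_Ioi (a := (0 : ℝ))]
  refine MeasureTheory.IntegrableOn.union ?_ ?_
  · refine (integrableOn_exp_mul_Iic hη 0).congr_fun (fun y hy => ?_) measurableSet_Iic
    simp only [abs_of_nonpos (show y ≤ 0 from hy)]
    congr 1; ring
  · refine (integrableOn_exp_mul_Ioi (neg_lt_zero.2 hη) 0).congr_fun (fun y hy => ?_)
      measurableSet_Ioi
    simp only [abs_of_pos (show 0 < y from hy)]

lemma hR_int {φ : ℝ} (h1 : -(Real.pi / 2) < φ) (h2 : φ < Real.pi / 2) :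
    MeasureTheory.Integrable (fun y : ℝ => ‖hR y‖ * Real.exp (y * φ)) := by
  obtain ⟨η, hη, ha, hb⟩ : ∃ η : ℝ, 0 < η ∧ -(Real.pi / 2) < φ - η ∧ φ + η < Real.pi / 2 := by
    refine ⟨min (φ + Real.pi / 2) (Real.pi / 2 - φ) / 2, ?_, ?_, ?_⟩
    · have : 0 < min (φ + Real.pi / 2) (Real.pi / 2 - φ) := lt_min (by linarith) (by linarith)
      linarith
    · have := min_le_left (φ + Real.pi / 2) (Real.pi / 2 - φ)
      linarith
    · have := min_le_right (φ + Real.pi / 2) (Real.pi / 2 - φ)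
      linarith
  obtain ⟨C₁, hC₁⟩ := hR_bound ha (by linarith)
  obtain ⟨C₂, hC₂⟩ := hR_bound (by linarith) hb
  refine MeasureTheory.Integrable.mono' ((h_exp_int hη).const_mul (max C₁ C₂)) ?_ ?_
  · have := hR_cont
    exact Continuous.aestronglyMeasurable (by fun_prop)
  · refine Filter.Eventually.of_forall (fun y => ?_)
    rw [Real.norm_of_nonneg (by positivity)]
    rcases le_total 0 y with hy | hy
    · have e : ‖hR y‖ * Real.exp (y * φ)
          = (‖hR y‖ * Real.exp (y * (φ + η))) * Real.exp (-η * |y|) := by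
        rw [mul_assoc, ← Real.exp_add, abs_of_nonneg hy]; congr 2; ring
      rw [e]
      exact mul_le_mul_of_nonneg_right ((hC₂ y).trans (le_max_right _ _)) (Real.exp_pos _).le
    · have e : ‖hR y‖ * Real.exp (y * φ)
          = (‖hR y‖ * Real.exp (y * (φ - η))) * Real.exp (-η * |y|) := by
        rw [mul_assoc, ← Real.exp_add, abs_of_nonpos hy]; congr 2; ring
      rw [e]
      exact mul_le_mul_of_nonneg_right ((hC₁ y).trans (le_max_left _ _)) (Real.exp_pos _).le

lemma h_arg_bd {w : ℂ} (hw : 0 < w.re) : -(Real.pi / 2) < arg w ∧ arg w < Real.pi / 2 := by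
  have := abs_arg_lt_pi_div_two_iff.2 (Or.inl hw)
  exact abs_lt.1 this

lemma hG_inversion {w : ℂ} (hw : 0 < w.re) :
    hG w = ((1 / (2 * Real.pi) : ℝ) : ℂ) *
      ∫ y : ℝ, w ^ (-(((1 / 4 : ℝ) : ℂ) + y * I)) * hR y := by
  obtain ⟨h1, h2⟩ := h_arg_bd hw
  have hw0 : w ≠ 0 := by rintro rfl; simp at hw
  have hv : Complex.VerticalIntegrable (mellin (fun x : ℝ => hG (w * x))) (1 / 4) := by
    have hi := (hR_int h1 h2).const_mul (‖w‖ ^ (-(1 / 4) : ℝ))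
    refine MeasureTheory.Integrable.mono' hi ?_ ?_
    · have : (fun y : ℝ => mellin (fun x : ℝ => hG (w * x)) (((1 / 4 : ℝ) : ℂ) + y * I))
          = fun y : ℝ => w ^ (-(((1 / 4 : ℝ) : ℂ) + y * I)) * hR y := by
        funext y; exact hM_line hw y
      rw [this]
      have := hR_cont
      refine Continuous.aestronglyMeasurable ?_
      refine Continuous.mul ?_ this
      exact Continuous.const_cpow (by fun_prop) (Or.inl hw0)
    · refine Filter.Eventually.of_forall (fun y => ?_)
      have := hM_line hw y
      rw [hM] at this
      rw [this, norm_mul, h_cpow_norm hw]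
      apply le_of_eq; ring
  have key := mellinInv_mellin_eq (1 / 4) (fun x : ℝ => hG (w * x)) (x := 1) one_pos
    (hM_conv hw (by norm_num) (by norm_num)) hv
    ((hG_contOn hw).continuousAt (Ioi_mem_nhds one_pos))
  rw [mellinInv] at key
  simp only [ofReal_one, mul_one, one_cpow, one_smul] at key
  rw [← key, Complex.real_smul]
  congr 1
  refine MeasureTheory.integral_congr_ae (Filter.Eventually.of_forall (fun y => ?_))
  exact hM_line hw y

lemma hG_le {w : ℂ} (hw : 0 < w.re) (hn : 1 ≤ ‖w‖) :
    ‖hG w‖ ≤ ∫ y : ℝ, ‖hR y‖ * Real.exp (y * arg w) := by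
  obtain ⟨h1, h2⟩ := h_arg_bd hw
  rw [hG_inversion hw, norm_mul, norm_real, Real.norm_of_nonneg (by positivity)]
  have a : 1 / (2 * Real.pi) ≤ 1 := by
    rw [div_le_one (by positivity)]; linarith [Real.pi_gt_three]
  refine (mul_le_of_le_one_left (norm_nonneg _) a).trans ?_
  refine MeasureTheory.norm_integral_le_of_norm_le (hR_int h1 h2)
    (Filter.Eventually.of_forall (fun y => ?_))
  rw [norm_mul, h_cpow_norm hw]
  have : ‖w‖ ^ (-(1 / 4) : ℝ) ≤ 1 := Real.rpow_le_one_of_one_le_of_nonpos hn (by norm_num)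
  calc _ = ‖w‖ ^ (-(1 / 4) : ℝ) * (‖hR y‖ * Real.exp (y * arg w)) := by ring
    _ ≤ _ := mul_le_of_le_one_left (by positivity) this

lemma hR_re_int_bd {φ : ℝ} (h0 : 0 ≤ φ) (h2 : φ < Real.pi / 2) :
    |∫ y : ℝ, (hR y).re * Real.exp (y * φ)| ≤ 4000 * Real.pi := by
  have h1 : -(Real.pi / 2) < φ := by linarith [Real.pi_pos]
  have hw := hw_re h1 h2
  have hi : 0 ≤ (exp (φ * I)).im := by
    rw [exp_ofReal_mul_I_im]
    exact Real.sin_nonneg_of_nonneg_of_le_pi h0 (by linarith [Real.pi_pos])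
  have hb := hG_bdd hw hi (norm_exp_ofReal_mul_I φ)
  have e : ∀ y : ℝ, exp (φ * I) ^ (-(((1 / 4 : ℝ) : ℂ) + y * I)) * hR y
      = exp (((-(φ / 4) : ℝ) : ℂ) * I) * (((hR y).re * Real.exp (y * φ) : ℝ) : ℂ) := by
    intro y
    have hr : hR y = ((hR y).re : ℂ) := by
      apply Complex.ext <;> simp [hR_real]
    rw [cpow_def_of_ne_zero (exp_ne_zero _), Complex.log_exp (by simp; linarith)
      (by simp; linarith)]
    have e2 : (φ * I) * (-(((1 / 4 : ℝ) : ℂ) + y * I))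
        = ((-(φ / 4) : ℝ) : ℂ) * I + ((y * φ : ℝ) : ℂ) := by
      push_cast
      linear_combination (-(φ : ℂ) * y) * I_mul_I
    rw [e2, Complex.exp_add, ← ofReal_exp, ofReal_mul, ← hr]
    ring
  rw [hG_inversion hw] at hb
  simp only [e] at hb
  rw [MeasureTheory.integral_const_mul, integral_complex_ofReal, norm_mul, norm_mul,
    norm_exp_ofReal_mul_I, one_mul, norm_real, norm_real, Real.norm_of_nonneg (by positivity),
    Real.norm_eq_abs, one_div, inv_mul_le_iff₀ (by positivity)] at hb
  linarith

lemma hR_unif {T : ℝ} (hT : 0 ≤ T) (h : ∀ y, T < y → hR y ≠ 0) :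
    ∃ B, ∀ φ, 0 ≤ φ → φ < Real.pi / 2 → ∫ y : ℝ, ‖hR y‖ * Real.exp (y * φ) ≤ B := by
  have hn : ∀ y, ‖hR y‖ = |(hR y).re| := by
    intro y
    have hr : hR y = ((hR y).re : ℂ) := by
      apply Complex.ext <;> simp [hR_real]
    rw [hr, norm_real, Real.norm_eq_abs, ofReal_re]
  have hc : Continuous fun y => (hR y).re := continuous_re.comp hR_cont
  have hne : ∀ y, T < y → (hR y).re ≠ 0 := by
    intro y hy h0
    apply h y hy
    apply Complex.ext <;> simp [hR_real, h0]
  obtain ⟨σ, hσ1, hσ⟩ : ∃ σ : ℝ, |σ| = 1 ∧ ∀ y, T < y → |(hR y).re| = σ * (hR y).re := by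
    have hp : IsPreconnected (Set.Ioi T) := isPreconnected_Ioi
    by_cases hpos : 0 < (hR (T + 1)).re
    · refine ⟨1, by simp, fun y hy => ?_⟩
      rw [one_mul, abs_of_nonneg]
      by_contra hneg
      push Not at hneg
      obtain ⟨z, hz, hz0⟩ := hp.intermediate_value (show y ∈ Set.Ioi T from hy)
        (show T + 1 ∈ Set.Ioi T by simp) hc.continuousOn ⟨hneg.le, hpos.le⟩
      exact hne z hz hz0
    · push Not at hpos
      refine ⟨-1, by simp, fun y hy => ?_⟩
      rw [abs_of_nonpos, neg_one_mul]
      by_contra hneg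
      push Not at hneg
      obtain ⟨z, hz, hz0⟩ := hp.intermediate_value (show T + 1 ∈ Set.Ioi T by simp)
        (show y ∈ Set.Ioi T from hy) hc.continuousOn ⟨hpos, hneg.le⟩
      exact hne z hz hz0
  have hI0 : MeasureTheory.Integrable (fun y : ℝ => ‖hR y‖) := by
    have := hR_int (φ := 0) (by linarith [Real.pi_pos]) (by linarith [Real.pi_pos])
    simpa using this
  refine ⟨4000 * Real.pi + ∫ y : ℝ, 2 * Real.exp (T * (Real.pi / 2)) * ‖hR y‖, ?_⟩
  intro φ h0 h2
  have hI := hR_int (φ := φ) (by linarith [Real.pi_pos]) h2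
  have hIre : MeasureTheory.Integrable (fun y : ℝ => (hR y).re * Real.exp (y * φ)) := by
    refine hI.mono (Continuous.aestronglyMeasurable (by fun_prop))
      (Filter.Eventually.of_forall (fun y => ?_))
    rw [norm_mul, norm_mul, norm_norm, hn y, Real.norm_eq_abs]
  have hb := hR_re_int_bd h0 h2
  have hJ : MeasureTheory.Integrable
      (fun y : ℝ => 2 * Real.exp (T * (Real.pi / 2)) * ‖hR y‖) := hI0.const_mul _
  have step : ∫ y : ℝ, ‖hR y‖ * Real.exp (y * φ) ≤
      ∫ y : ℝ, (σ * ((hR y).re * Real.exp (y * φ)) + 2 * Real.exp (T * (Real.pi / 2)) * ‖hR y‖) := by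
    refine MeasureTheory.integral_mono hI ((hIre.const_mul σ).add hJ) (fun y => ?_)
    have p := Real.exp_pos (y * φ)
    simp only
    rcases lt_or_ge T y with hy | hy
    · have : ‖hR y‖ = σ * (hR y).re := by rw [hn, hσ y hy]
      have q : 0 ≤ 2 * Real.exp (T * (Real.pi / 2)) * ‖hR y‖ := by positivity
      calc ‖hR y‖ * Real.exp (y * φ) = σ * ((hR y).re * Real.exp (y * φ)) := by rw [this]; ring
        _ ≤ _ := by linarith
    · have q : Real.exp (y * φ) ≤ Real.exp (T * (Real.pi / 2)) := by
        apply Real.exp_le_exp.2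
        calc y * φ ≤ T * φ := mul_le_mul_of_nonneg_right hy h0
          _ ≤ _ := mul_le_mul_of_nonneg_left h2.le hT
      have r : -(‖hR y‖ * Real.exp (y * φ)) ≤ σ * ((hR y).re * Real.exp (y * φ)) := by
        apply neg_le_of_abs_le
        rw [abs_mul, hσ1, one_mul, abs_mul, abs_of_pos p, hn]
      have s := mul_le_mul_of_nonneg_left q (norm_nonneg (hR y))
      linarith
  rw [MeasureTheory.integral_add (hIre.const_mul σ) hJ, MeasureTheory.integral_const_mul] at step
  have u : σ * ∫ y : ℝ, (hR y).re * Real.exp (y * φ) ≤ 4000 * Real.pi := by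
    refine (le_abs_self _).trans ?_
    rwa [abs_mul, hσ1, one_mul]
  linarith

/-- **Hardy's theorem.** The Riemann zeta function has infinitely many zeros on
the critical line `Re s = 1/2`. -/
theorem hardy_infinitely_many_critical_zeros :
    {t : ℝ | riemannZeta (1/2 + t * Complex.I) = 0}.Infinite := by
  intro hfin
  obtain ⟨M, hM⟩ := hfin.bddAbove
  obtain ⟨B, hB⟩ := hR_unif (T := max M 0) (le_max_right _ _) (fun y hy => by
    refine hR_ne (fun h0 => ?_)
    have h3 := hM (show (2 * y) ∈ {t : ℝ | riemannZeta (1/2 + t * Complex.I) = 0} from h0)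
    have h4 := le_max_left M 0
    have h5 := le_max_right M 0
    linarith)
  obtain ⟨d, hd, hd1, hlt⟩ := hG_unbdd B
  have hre : 0 < (6 * ((d : ℂ) + I)).re := by simp; exact hd
  have him : 0 ≤ (6 * ((d : ℂ) + I)).im := by simp
  have hn : 1 ≤ ‖6 * ((d : ℂ) + I)‖ := by
    refine le_trans ?_ (abs_im_le_norm _)
    simp
  have := hG_le hre hn
  have := hB _ (arg_nonneg_iff.2 him) (h_arg_bd hre).2
  linarith
end

section
/- (Lemma 3.1) Let 1 < c < 2. Then for any real x ≠ 0, any z ∈ ℂ, and any Δ > 0, (1/(iΔ√π)) ∫_{(c)} e^{(s−z)²Δ^{−2}} Γ(s) (2πix)^{−s} ds = ∫₀^∞ v^z exp(−Δ²(log v)²/4) e(−xv) dv/v, where the left-hand integral is over the vertical line Re(s) = c and e(u) = e^{2πiu}. -/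
open Complex

open MeasureTheory Set Filter Topology in
theorem wu_aux_int {σ ε : ℝ} (hσ : 0 < σ) (hε : 0 < ε) :
    IntegrableOn (fun v : ℝ => v ^ (σ - 1) * Real.exp (-(ε * v))) (Ioi 0) := by
  have := integrableOn_rpow_mul_exp_neg_mul_rpow (p := 1) (s := σ - 1) (b := ε)
    (by linarith) one_pos hε
  simpa using this

open MeasureTheory Set Filter Topology in
theorem wu_aux_norm {s A : ℂ} {v : ℝ} (hv : 0 < v) :
    ‖(v : ℂ) ^ (s - 1) * cexp (-(A * v))‖ = v ^ (s.re - 1) * Real.exp (-(A.re * v)) := by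
  rw [norm_mul, norm_cpow_eq_rpow_re_of_pos hv, Complex.norm_exp]
  simp

open MeasureTheory Set Filter Topology in
theorem wu_aux_gamma {s A : ℂ} (hs : 0 < s.re) (hA : 0 < A.re) :
    ∫ v in Ioi (0:ℝ), (v : ℂ) ^ (s - 1) * cexp (-(A * v)) = A ^ (-s) * Gamma s := by
  set U : Set ℂ := {A : ℂ | 0 < A.re} with hU
  have hUo : IsOpen U := isOpen_lt continuous_const continuous_re
  have hmeas : ∀ B : ℂ, AEStronglyMeasurable
      (fun v : ℝ => (v : ℂ) ^ (s - 1) * cexp (-(B * v))) (volume.restrict (Ioi 0)) := by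
    intro B
    apply Measurable.aestronglyMeasurable
    fun_prop
  have hint : ∀ B ∈ U, Integrable
      (fun v : ℝ => (v : ℂ) ^ (s - 1) * cexp (-(B * v))) (volume.restrict (Ioi 0)) := by
    intro B hB
    refine Integrable.mono' (wu_aux_int hs hB) (hmeas B) ?_
    refine (ae_restrict_iff' measurableSet_Ioi).2 (Eventually.of_forall fun v hv => ?_)
    exact (wu_aux_norm hv).le
  have hd : DifferentiableOn ℂ
      (fun B : ℂ => ∫ v in Ioi (0:ℝ), (v : ℂ) ^ (s - 1) * cexp (-(B * v))) U := by
    intro B hB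
    have hB' : 0 < B.re := hB
    refine DifferentiableAt.differentiableWithinAt ?_
    refine (hasDerivAt_integral_of_dominated_loc_of_deriv_le (s := {C : ℂ | B.re / 2 < C.re})
      (F' := fun C v => (v : ℂ) ^ (s - 1) * (cexp (-(C * v)) * (-v)))
      (bound := fun v : ℝ => v ^ (s.re + 1 - 1) * Real.exp (-(B.re / 2 * v)))
      ?_ (Eventually.of_forall hmeas) (hint B hB) ?_ ?_
      (wu_aux_int (by linarith) (by linarith)) ?_).2.differentiableAt
    · exact (isOpen_lt continuous_const continuous_re).mem_nhds (by simp; linarith)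
    · apply Measurable.aestronglyMeasurable
      fun_prop
    · refine (ae_restrict_iff' measurableSet_Ioi).2 (Eventually.of_forall fun v hv C hC => ?_)
      have hv' : 0 < v := hv
      have hC' : B.re / 2 < C.re := hC
      rw [← mul_assoc, norm_mul, wu_aux_norm hv, norm_neg, Complex.norm_of_nonneg hv'.le,
        mul_right_comm]
      have : v ^ (s.re - 1) * v = v ^ (s.re + 1 - 1) := by
        rw [← Real.rpow_add_one hv'.ne']; ring_nf
      rw [this]
      gcongr
    · refine Eventually.of_forall fun v C hC => ?_
      refine HasDerivAt.const_mul _ (HasDerivAt.cexp ?_)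
      have h := ((hasDerivAt_id C).mul_const (v : ℂ)).neg
      rw [one_mul] at h
      exact h
  have hd2 : DifferentiableOn ℂ (fun B : ℂ => B ^ (-s) * Gamma s) U := by
    intro B hB
    refine DifferentiableAt.differentiableWithinAt ?_
    exact (DifferentiableAt.cpow_const (differentiableAt_id) (Or.inl hB)).mul_const _
  have hreal : ∀ r : ℝ, 0 < r → 
      ∫ v in Ioi (0:ℝ), (v : ℂ) ^ (s - 1) * cexp (-((r:ℂ) * v)) = (r:ℂ) ^ (-s) * Gamma s := by
    intro r hr
    rw [integral_cpow_mul_exp_neg_mul_Ioi hs hr, one_div, inv_cpow, cpow_neg]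
    rw [arg_ofReal_of_nonneg hr.le]
    exact Real.pi_pos.ne
  have hconn : IsPreconnected U := (convex_halfSpace_re_gt 0).isPreconnected
  have h1 : (1:ℂ) ∈ U := by simp [hU]
  refine AnalyticOnNhd.eqOn_of_preconnected_of_frequently_eq (hd.analyticOnNhd hUo)
    (hd2.analyticOnNhd hUo) hconn h1 ?_ hA
  have ht : Tendsto (fun n : ℕ => (((1 + 1 / ((n:ℝ) + 1) : ℝ)) : ℂ)) atTop (𝓝[≠] 1) := by
    refine tendsto_nhdsWithin_iff.2 ⟨?_, Eventually.of_forall fun n => ?_⟩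
    · have := (tendsto_one_div_add_atTop_nhds_zero_nat (𝕜 := ℝ)).const_add 1
      have := (continuous_ofReal.tendsto _).comp this
      simpa [Function.comp_def] using this
    · simp only [mem_compl_iff, mem_singleton_iff]
      rw [ofReal_eq_one]
      have : 0 < 1 / ((n:ℝ) + 1) := by positivity
      linarith
  refine ht.frequently (Frequently.of_forall fun n => ?_)
  exact hreal _ (by positivity)

theorem wu_aux_sq (c : ℝ) (z : ℂ) (Δ : ℝ) (hΔ : 0 < Δ) (t : ℝ) (p q : ℂ) :
    cexp ((((c:ℂ) + I*(t:ℂ)) - z)^2 / (Δ:ℂ)^2) * cexp (p * t + q) =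
    cexp (-(1 / (Δ:ℂ)^2) * (t:ℂ)^2 + (2 * I * (c - z) / (Δ:ℂ)^2 + p) * t
      + ((c - z)^2 / (Δ:ℂ)^2 + q)) := by
  rw [← Complex.exp_add]
  congr 1
  have : (Δ:ℂ) ≠ 0 := by exact_mod_cast hΔ.ne'
  field_simp
  linear_combination (t:ℂ)^2 * I_sq

theorem wu_aux_re {Δ : ℝ} (hΔ : 0 < Δ) : (-(1 / (Δ:ℂ)^2)).re < 0 := by
  have : (-(1 / (Δ:ℂ)^2)) = ((-(1 / Δ^2) : ℝ) : ℂ) := by push_cast; rfl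
  rw [this, ofReal_re]
  have : 0 < 1 / Δ^2 := by positivity
  linarith

open MeasureTheory in
theorem wu_aux_winf (c : ℝ) (z : ℂ) (Δ : ℝ) (hΔ : 0 < Δ) (p q : ℂ) :
    Integrable (fun t : ℝ =>
      cexp ((((c:ℂ) + I*(t:ℂ)) - z)^2 / (Δ:ℂ)^2) * cexp (p * t + q)) := by
  simp_rw [wu_aux_sq c z Δ hΔ]
  exact integrable_cexp_quadratic' (wu_aux_re hΔ) _ _

theorem wu_aux_inner (c : ℝ) (z : ℂ) (Δ : ℝ) (hΔ : 0 < Δ) (v : ℝ) (hv : 0 < v) :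
    ∫ t : ℝ, cexp ((((c:ℂ) + I*(t:ℂ)) - z)^2 / (Δ:ℂ)^2) * (v:ℂ) ^ ((c:ℂ) + I*(t:ℂ) - 1) =
    (Δ : ℂ) * ((Real.sqrt Real.pi : ℝ) : ℂ) *
      ((v:ℂ) ^ (z - 1) * ((Real.exp (-(Δ^2) * (Real.log v)^2 / 4) : ℝ) : ℂ)) := by
  have hv0 : (v:ℂ) ≠ 0 := by exact_mod_cast hv.ne'
  have hD : (Δ:ℂ) ≠ 0 := by exact_mod_cast hΔ.ne'
  have h1 : ∀ t : ℝ, (v:ℂ) ^ ((c:ℂ) + I*(t:ℂ) - 1) =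
      cexp ((I * Real.log v) * t + Real.log v * (c - 1)) := by
    intro t
    rw [cpow_def_of_ne_zero hv0, ← ofReal_log hv.le]
    congr 1; ring
  simp_rw [h1, wu_aux_sq c z Δ hΔ]
  rw [integral_cexp_quadratic (wu_aux_re hΔ)]
  have h2 : ((Real.pi:ℂ) / - -(1 / (Δ:ℂ)^2)) ^ (1/2 : ℂ) =
      (Δ : ℂ) * ((Real.sqrt Real.pi : ℝ) : ℂ) := by
    have : ((Real.pi:ℂ) / - -(1 / (Δ:ℂ)^2)) = ((Δ^2 * Real.pi : ℝ) : ℂ) := by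
      push_cast; field_simp
    rw [this, show (1/2 : ℂ) = ((1/2 : ℝ) : ℂ) by push_cast; rfl,
      ← ofReal_cpow (by positivity), ← Real.sqrt_eq_rpow, Real.sqrt_mul (by positivity),
      Real.sqrt_sq hΔ.le, ofReal_mul]
  rw [h2, cpow_def_of_ne_zero hv0, ← ofReal_log hv.le, ofReal_exp, ← Complex.exp_add]
  congr 2
  push_cast
  field_simp
  ring_nf
  simp only [I_sq]
  ring

open MeasureTheory Set Filter Topology in
theorem wu_aux_fubini (c : ℝ) (hc : 0 < c) (z : ℂ) (Δ : ℝ) (hΔ : 0 < Δ) (A : ℂ) (hA : 0 < A.re) :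
    ∫ t : ℝ, cexp ((((c:ℂ) + I*(t:ℂ)) - z)^2 / (Δ:ℂ)^2) *
        Complex.Gamma ((c:ℂ) + I*(t:ℂ)) * A ^ (-((c:ℂ) + I*(t:ℂ)))
    = (Δ : ℂ) * ((Real.sqrt Real.pi : ℝ) : ℂ) * ∫ v in Ioi (0:ℝ), ((v : ℂ) ^ (z - 1)) *
        ((Real.exp (-(Δ^2) * (Real.log v)^2 / 4) : ℝ) : ℂ) * cexp (-(A * (v : ℂ))) := by
  have h1 : ∀ t : ℝ, cexp ((((c:ℂ) + I*(t:ℂ)) - z)^2 / (Δ:ℂ)^2) *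
        Complex.Gamma ((c:ℂ) + I*(t:ℂ)) * A ^ (-((c:ℂ) + I*(t:ℂ))) =
      ∫ v in Ioi (0:ℝ), cexp ((((c:ℂ) + I*(t:ℂ)) - z)^2 / (Δ:ℂ)^2) *
        ((v : ℂ) ^ ((c:ℂ) + I*(t:ℂ) - 1) * cexp (-(A * v))) := by
    intro t
    rw [integral_const_mul, wu_aux_gamma (by simpa using hc) hA]
    ring
  simp_rw [h1]
  rw [integral_integral_swap]
  · rw [← integral_const_mul]
    refine setIntegral_congr_fun measurableSet_Ioi fun v hv => ?_
    simp_rw [← mul_assoc]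
    rw [integral_mul_const, wu_aux_inner c z Δ hΔ v hv]
    ring
  · have hw := (wu_aux_winf c z Δ hΔ 0 0).norm
    simp only [zero_mul, add_zero, Complex.exp_zero, mul_one] at hw
    refine Integrable.mono' (hw.mul_prod (wu_aux_int hc hA)) ?_ ?_
    · apply Measurable.aestronglyMeasurable
      unfold Function.uncurry
      fun_prop
    · rw [← Measure.restrict_univ (μ := (volume : Measure ℝ)), Measure.prod_restrict]
      simp only [Measure.restrict_univ]
      refine (ae_restrict_iff' (MeasurableSet.univ.prod measurableSet_Ioi)).2
        (Eventually.of_forall ?_)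
      rintro ⟨t, v⟩ ⟨-, hv⟩
      simp only [Function.uncurry]
      rw [norm_mul, wu_aux_norm hv]
      simp

open MeasureTheory Set Filter Topology in
theorem wu_aux_vint (z : ℂ) (Δ : ℝ) (hΔ : 0 < Δ) :
    IntegrableOn (fun v : ℝ => ‖((v : ℂ) ^ (z - 1)) *
        ((Real.exp (-(Δ^2) * (Real.log v)^2 / 4) : ℝ) : ℂ)‖) (Ioi 0) := by
  have himg : Real.exp '' univ = Ioi 0 := by rw [image_univ, Real.range_exp]
  rw [← himg, integrableOn_image_iff_integrableOn_abs_deriv_smul MeasurableSet.univ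
    (fun x _ => (Real.hasDerivAt_exp x).hasDerivWithinAt) Real.exp_injective.injOn,
    integrableOn_univ]
  have hb : (-((Δ^2/4 : ℝ) : ℂ)).re < 0 := by
    rw [neg_re, ofReal_re]
    have : 0 < Δ^2/4 := by positivity
    linarith
  refine (integrable_cexp_quadratic' hb z 0).norm.congr (Eventually.of_forall fun u => ?_)
  simp only
  rw [norm_mul, norm_cpow_eq_rpow_re_of_pos (Real.exp_pos u), Real.log_exp,
    Complex.norm_of_nonneg (Real.exp_pos _).le, abs_of_pos (Real.exp_pos u), ← Real.exp_mul,
    smul_eq_mul, ← Real.exp_add, ← Real.exp_add, Complex.norm_exp]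
  congr 1
  simp [← ofReal_pow]
  ring

theorem wu_aux_gnorm (c : ℝ) (hc : 0 < c) (t : ℝ) :
    ‖Complex.Gamma ((c:ℂ) + I*(t:ℂ))‖ ≤ Real.Gamma c := by
  rw [Complex.Gamma_eq_integral (by simpa using hc), Real.Gamma_eq_integral hc,
    Complex.GammaIntegral]
  refine (MeasureTheory.norm_integral_le_integral_norm _).trans (le_of_eq ?_)
  refine MeasureTheory.setIntegral_congr_fun measurableSet_Ioi fun v hv => ?_
  rw [norm_mul, norm_cpow_eq_rpow_re_of_pos hv, Complex.norm_of_nonneg (Real.exp_pos _).le]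
  simp

theorem wu_aux_pnorm (c : ℝ) (hc : 0 < c) (t : ℝ) (A B : ℂ) (hB : 0 < ‖B‖) (hAB : ‖B‖ ≤ ‖A‖)
    (hA : 0 ≤ A.re) :
    ‖A ^ (-((c:ℂ) + I*(t:ℂ)))‖ ≤
      ‖B‖ ^ (-c) * (Real.exp (Real.pi / 2 * t) + Real.exp (-(Real.pi / 2) * t)) := by
  have hA0 : 0 < ‖A‖ := hB.trans_le hAB
  rw [norm_cpow_of_ne_zero (norm_pos_iff.1 hA0), div_eq_mul_inv, ← Real.exp_neg]
  have ha := abs_arg_le_pi_div_two_iff.2 hA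
  have hre : (-((c:ℂ) + I*(t:ℂ))).re = -c := by simp
  have him : (-((c:ℂ) + I*(t:ℂ))).im = -t := by simp
  rw [hre, him]
  have h1 : ‖A‖ ^ (-c) ≤ ‖B‖ ^ (-c) :=
    Real.rpow_le_rpow_of_nonpos hB hAB (by linarith)
  have h2 : Real.exp (-(A.arg * -t)) ≤
      Real.exp (Real.pi / 2 * t) + Real.exp (-(Real.pi / 2) * t) := by
    obtain ⟨h3, h4⟩ := abs_le.1 ha
    rcases le_total 0 t with h | h
    · have : Real.exp (-(A.arg * -t)) ≤ Real.exp (Real.pi / 2 * t) :=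
        Real.exp_le_exp.2 (by nlinarith)
      have := Real.exp_pos (-(Real.pi / 2) * t)
      linarith
    · have : Real.exp (-(A.arg * -t)) ≤ Real.exp (-(Real.pi / 2) * t) :=
        Real.exp_le_exp.2 (by nlinarith)
      have := Real.exp_pos (Real.pi / 2 * t)
      linarith
  exact mul_le_mul h1 h2 (Real.exp_pos _).le (by positivity)

open MeasureTheory Set Filter Topology in
theorem wu_aux_main (c : ℝ) (hc : 0 < c) (z : ℂ) (Δ : ℝ) (hΔ : 0 < Δ) (B : ℂ) (hB : B.re = 0)
    (hB0 : B.im ≠ 0) :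
    ∫ t : ℝ, cexp ((((c:ℂ) + I*(t:ℂ)) - z)^2 / (Δ:ℂ)^2) *
        Complex.Gamma ((c:ℂ) + I*(t:ℂ)) * B ^ (-((c:ℂ) + I*(t:ℂ)))
    = (Δ : ℂ) * ((Real.sqrt Real.pi : ℝ) : ℂ) * ∫ v in Ioi (0:ℝ), ((v : ℂ) ^ (z - 1)) *
        ((Real.exp (-(Δ^2) * (Real.log v)^2 / 4) : ℝ) : ℂ) * cexp (-(B * (v : ℂ))) := by
  have hBn : 0 < ‖B‖ := norm_pos_iff.2 (fun h => hB0 (by simp [h]))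
  have hBs : B ∈ slitPlane := Or.inr hB0
  have hlim : Tendsto (fun ε : ℝ => (ε : ℂ) + B) (𝓝[>] 0) (𝓝 B) := by
    have : Tendsto (fun ε : ℝ => (ε : ℂ) + B) (𝓝 0) (𝓝 (((0:ℝ):ℂ) + B)) :=
      Continuous.tendsto (by fun_prop) 0
    rw [ofReal_zero, zero_add] at this
    exact this.mono_left nhdsWithin_le_nhds
  have hpos : ∀ᶠ ε : ℝ in 𝓝[>] 0, 0 < ε := eventually_mem_nhdsWithin
  have hre : ∀ ε : ℝ, ((ε : ℂ) + B).re = ε := fun ε => by simp [hB]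
  have hle : ∀ ε : ℝ, ‖B‖ ≤ ‖(ε : ℂ) + B‖ := by
    intro ε
    rw [← sq_le_sq₀ (norm_nonneg _) (norm_nonneg _), Complex.sq_norm, Complex.sq_norm,
      normSq_apply, normSq_apply, hre]
    simp [hB]
    nlinarith [mul_self_nonneg ε]
  have hG : Continuous (fun t : ℝ => Complex.Gamma ((c:ℂ) + I*(t:ℂ))) := by
    rw [continuous_iff_continuousAt]
    intro t
    refine ContinuousAt.comp (f := fun t : ℝ => (c:ℂ) + I*(t:ℂ)) ?_ (by fun_prop)
    refine continuousAt_Gamma _ fun m h => ?_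
    have := congrArg re h
    simp at this
    have hm : (0:ℝ) ≤ m := m.cast_nonneg
    linarith
  have hleft : Tendsto (fun ε : ℝ => ∫ t : ℝ, cexp ((((c:ℂ) + I*(t:ℂ)) - z)^2 / (Δ:ℂ)^2) *
        Complex.Gamma ((c:ℂ) + I*(t:ℂ)) * ((ε : ℂ) + B) ^ (-((c:ℂ) + I*(t:ℂ)))) (𝓝[>] 0)
      (𝓝 (∫ t : ℝ, cexp ((((c:ℂ) + I*(t:ℂ)) - z)^2 / (Δ:ℂ)^2) *
        Complex.Gamma ((c:ℂ) + I*(t:ℂ)) * B ^ (-((c:ℂ) + I*(t:ℂ))))) := by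
    refine tendsto_integral_filter_of_dominated_convergence
      (fun t : ℝ => Real.Gamma c * ‖B‖ ^ (-c) *
        (‖cexp ((((c:ℂ) + I*(t:ℂ)) - z)^2 / (Δ:ℂ)^2) * cexp (((Real.pi / 2 : ℝ):ℂ) * t + 0)‖ +
        ‖cexp ((((c:ℂ) + I*(t:ℂ)) - z)^2 / (Δ:ℂ)^2) * cexp (((-(Real.pi / 2) : ℝ):ℂ) * t + 0)‖))
      ?_ ?_ ?_ ?_
    · refine Eventually.of_forall fun ε => ?_
      apply Measurable.aestronglyMeasurable
      have := hG.measurable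
      fun_prop
    · filter_upwards [hpos] with ε hε
      refine Eventually.of_forall fun t => ?_
      have e1 : ∀ r : ℝ, ‖cexp ((r:ℂ) * t + 0)‖ = Real.exp (r * t) := by
        intro r
        rw [Complex.norm_exp, add_zero, re_ofReal_mul, ofReal_re]
      rw [norm_mul, norm_mul, norm_mul, norm_mul, e1, e1]
      calc _ ≤ ‖cexp ((((c:ℂ) + I*(t:ℂ)) - z)^2 / (Δ:ℂ)^2)‖ * Real.Gamma c *
            (‖B‖ ^ (-c) * (Real.exp (Real.pi / 2 * t) + Real.exp (-(Real.pi / 2) * t))) := by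
            gcongr
            · exact wu_aux_gnorm c hc t
            · exact wu_aux_pnorm c hc t _ B hBn (hle ε) (by rw [hre]; exact hε.le)
        _ = _ := by ring
    · exact ((wu_aux_winf c z Δ hΔ _ 0).norm.add (wu_aux_winf c z Δ hΔ _ 0).norm).const_mul _
    · refine Eventually.of_forall fun t => ?_
      refine Tendsto.const_mul _ ?_
      exact hlim.cpow tendsto_const_nhds hBs
  have hright : Tendsto (fun ε : ℝ => ∫ v in Ioi (0:ℝ), ((v : ℂ) ^ (z - 1)) *
        ((Real.exp (-(Δ^2) * (Real.log v)^2 / 4) : ℝ) : ℂ) * cexp (-(((ε : ℂ) + B) * (v : ℂ))))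
      (𝓝[>] 0)
      (𝓝 (∫ v in Ioi (0:ℝ), ((v : ℂ) ^ (z - 1)) *
        ((Real.exp (-(Δ^2) * (Real.log v)^2 / 4) : ℝ) : ℂ) * cexp (-(B * (v : ℂ))))) := by
    refine tendsto_integral_filter_of_dominated_convergence _ ?_ ?_ (wu_aux_vint z Δ hΔ) ?_
    · refine Eventually.of_forall fun ε => ?_
      apply Measurable.aestronglyMeasurable
      fun_prop
    · filter_upwards [hpos] with ε hε
      refine (ae_restrict_iff' measurableSet_Ioi).2 (Eventually.of_forall fun v hv => ?_)
      have hv' : 0 < v := hv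
      rw [norm_mul _ (cexp _)]
      refine mul_le_of_le_one_right (norm_nonneg _) ?_
      rw [Complex.norm_exp, Real.exp_le_one_iff, neg_re, re_mul_ofReal, hre]
      have := mul_pos hε hv'
      linarith
    · refine Eventually.of_forall fun v => ?_
      refine Tendsto.const_mul _ ?_
      exact (hlim.mul_const _).neg.cexp
  refine tendsto_nhds_unique hleft ((hright.const_mul _).congr' ?_)
  filter_upwards [hpos] with ε hε
  exact (wu_aux_fubini c hc z Δ hΔ _ (by rw [hre]; exact hε)).symm

/-- **Lemma 3.1 (Wu).** For `1 < c < 2`, any real `x ≠ 0`, any `z ∈ ℂ` and any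
`Δ > 0`,
`(1/(iΔ√π)) ∫_{(c)} e^{(s−z)²Δ^{−2}} Γ(s) (2πix)^{−s} ds`
`= ∫₀^∞ v^z exp(−Δ²(log v)²/4) e(−xv) dv/v`, where `e(u) = e^{2πiu}`. -/
theorem wu_lemma_3_1
    (c : ℝ) (hc1 : 1 < c) (hc2 : c < 2)
    (x : ℝ) (hx : x ≠ 0) (z : ℂ) (Δ : ℝ) (hΔ : 0 < Δ) :
    (I * (Δ : ℂ) * ((Real.sqrt Real.pi : ℝ) : ℂ))⁻¹ *
      ∫ t : ℝ, I * Complex.exp ((((c:ℂ) + I*(t:ℂ)) - z)^2 / (Δ:ℂ)^2) *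
        Complex.Gamma ((c:ℂ) + I*(t:ℂ)) *
        (2 * (Real.pi : ℂ) * I * (x : ℂ)) ^ (-((c:ℂ) + I*(t:ℂ)))
    = ∫ v in Set.Ioi (0:ℝ), ((v : ℂ) ^ z) *
        ((Real.exp (-(Δ^2) * (Real.log v)^2 / 4) : ℝ) : ℂ) *
        Complex.exp (-(2 * (Real.pi : ℂ) * I * (x : ℂ) * (v : ℂ))) / (v : ℂ) := by
  simp_rw [mul_assoc I]
  rw [MeasureTheory.integral_const_mul]
  have h := wu_aux_main c (by linarith) z Δ hΔ (2 * (Real.pi : ℂ) * I * (x : ℂ))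
    (by simp) (by simpa using hx)
  simp_rw [← mul_assoc]
  rw [mul_assoc _ I, h]
  have hD : (Δ:ℂ) ≠ 0 := by exact_mod_cast hΔ.ne'
  have hP : ((Real.sqrt Real.pi : ℝ) : ℂ) ≠ 0 := by
    exact_mod_cast (Real.sqrt_pos.2 Real.pi_pos).ne'
  rw [← mul_assoc I, ← mul_assoc I, inv_mul_cancel_left₀ (mul_ne_zero (mul_ne_zero I_ne_zero hD) hP)]
  refine MeasureTheory.setIntegral_congr_fun measurableSet_Ioi fun v hv => ?_
  have hv0 : (v:ℂ) ≠ 0 := by exact_mod_cast (Set.mem_Ioi.1 hv).ne'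
  rw [cpow_sub _ _ hv0, cpow_one]
  ring
end
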